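/- arXiv:1111.2212 — 5 statements merged into one kernel-verified Lean document; each statement's English description precedes it below -/
import Mathlib

section
/- Let n be a non-negative integer and let k ∈ GL₂(F) be such that both k and k^{-1} have entries k₁₁, k₂₂ ∈ o_F, k₁₂ ∈ p_F^{-n}, k₂₁ ∈ p_F^n (i.e. k is a unit of the order ((o_F, p_F^{-n}),(p_F^n, o_F)) in M₂(F)). Then for every s ∈ ℂ with Re(s) > 0, z(s, k, Φ_n) = L_E(s,1) = 1/(1 − q^{-2s}). -/
set_option autoImplicit false

open MeasureTheory Matrix

noncomputable section

/-- The zeta integral `z(s, g, Φ) = ∫_{F^×} (gΦ)(0,r) |r|_E^s d^×r`, where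
`|r|_E = |r|_F^2` and `d^×r` is the measure `μ`. -/
def zInt {F : Type} [Field F] [MeasurableSpace F] (μ : Measure F)
    (absF : F → ℝ) (s : ℂ) (g : Matrix (Fin 2) (Fin 2) F) (Φ : F × F → ℂ) : ℂ :=
  ∫ r, Φ (r * g 1 0, r * g 1 1) * Complex.ofReal (absF r ^ 2) ^ s ∂μ

/-- `Φ_n`, the characteristic function of `p_F^n ⊕ o_F`. -/
def PhiN {F : Type} [Field F] (q : ℝ) (absF : F → ℝ) (n : ℤ) : F × F → ℂ :=
  fun p => if absF p.1 ≤ q ^ (-n) ∧ absF p.2 ≤ 1 then 1 else 0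

/-- `L_E(s, 1) = 1 / (1 - q^{-2s})`. -/
def LEfac (q : ℝ) (s : ℂ) : ℂ := 1 / (1 - (q : ℂ) ^ (-2 * s))

/-- `(|r|^2)^s = (q^{-2s})^m` when `|r| = q^{-m}`. -/
theorem cpow_aux (q : ℝ) (hq : 1 < q) (s : ℂ) (m : ℕ) :
    Complex.ofReal ((q ^ (-(m : ℤ))) ^ 2) ^ s = ((q : ℂ) ^ (-2 * s)) ^ m := by
  have hq0 : 0 < q := by linarith
  have hp : (0 : ℝ) < (q ^ (-(m : ℤ))) ^ 2 := by positivity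
  rw [Complex.cpow_def_of_ne_zero (by exact_mod_cast hp.ne'),
    Complex.cpow_def_of_ne_zero (by exact_mod_cast hq0.ne'),
    ← Complex.exp_nat_mul, ← Complex.ofReal_log hp.le, ← Complex.ofReal_log hq0.le,
    Real.log_pow, Real.log_zpow]
  congr 1
  push_cast
  ring

theorem cnorm_aux (q : ℝ) (hq : 1 < q) (s : ℂ) (hs : 0 < s.re) :
    ‖(q : ℂ) ^ (-2 * s)‖ < 1 := by
  rw [Complex.norm_cpow_eq_rpow_re_of_pos (by linarith)]
  apply Real.rpow_lt_one_of_one_lt_of_neg hq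
  simp
  linarith

/-- For `k` a unit of the order `((o_F, p_F^{-n}), (p_F^n, o_F))` in `M₂(F)` and
`Re(s) > 0`, one has `z(s, k, Φ_n) = L_E(s, 1) = 1/(1 - q^{-2s})`. -/
theorem stmt_1
    (F : Type) [Field F] [CharZero F]
    (q : ℝ) (hq : 1 < q)
    (absF : F → ℝ)
    (habsF0 : ∀ x : F, absF x = 0 ↔ x = 0)
    (habsFmul : ∀ x y : F, absF (x * y) = absF x * absF y)
    (habsFadd : ∀ x y : F, absF (x + y) ≤ max (absF x) (absF y))
    (ϖ : F) (hϖ : absF ϖ = q⁻¹)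
    (hvalF : ∀ x : F, x ≠ 0 → ∃ m : ℤ, absF x = q ^ m)
    (habsF2 : absF 2 = 1)
    [MeasurableSpace F]
    (habsFmeas : Measurable absF)
    (hFmulmeas : Measurable fun p : F × F => p.1 * p.2)
    (hFaddmeas : Measurable fun p : F × F => p.1 + p.2)
    (μ : Measure F) [SigmaFinite μ]
    (hμ0 : μ {0} = 0)
    (hμinv : ∀ a : F, a ≠ 0 → Measure.map (fun x => a * x) μ = μ)
    (hμ1 : μ {x : F | absF x = 1} = 1)
    (n : ℕ)
    (k kinv : Matrix (Fin 2) (Fin 2) F)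
    (hkinv1 : k * kinv = 1) (hkinv2 : kinv * k = 1)
    (hk00 : absF (k 0 0) ≤ 1) (hk11 : absF (k 1 1) ≤ 1)
    (hk01 : absF (k 0 1) ≤ q ^ (n : ℤ)) (hk10 : absF (k 1 0) ≤ q ^ (-n : ℤ))
    (hki00 : absF (kinv 0 0) ≤ 1) (hki11 : absF (kinv 1 1) ≤ 1)
    (hki01 : absF (kinv 0 1) ≤ q ^ (n : ℤ)) (hki10 : absF (kinv 1 0) ≤ q ^ (-n : ℤ))
    (s : ℂ) (hs : 0 < s.re) :
    zInt μ absF s k (PhiN q absF (n : ℤ)) = LEfac q s := by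
  have hq0 : 0 < q := by linarith
  have hnn : ∀ x : F, 0 ≤ absF x := by
    intro x
    by_cases hx : x = 0
    · rw [(habsF0 x).2 hx]
    · obtain ⟨m, hm⟩ := hvalF x hx
      rw [hm]; positivity
  have hcond : ∀ r : F, (absF (r * k 1 0) ≤ q ^ (-(n : ℤ)) ∧ absF (r * k 1 1) ≤ 1) ↔
      absF r ≤ 1 := by
    intro r
    constructor
    · rintro ⟨h1, h2⟩
      have e : k 1 0 * kinv 0 1 + k 1 1 * kinv 1 1 = 1 := by
        have := congrFun (congrFun hkinv1 1) 1
        simpa [Matrix.mul_apply, Fin.sum_univ_two] using this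
      have e2 : r = r * k 1 0 * kinv 0 1 + r * k 1 1 * kinv 1 1 := by
        linear_combination (-r) * e
      rw [e2]
      refine (habsFadd _ _).trans (max_le ?_ ?_)
      · rw [habsFmul]
        calc _ ≤ q ^ (-(n : ℤ)) * q ^ (n : ℤ) :=
              mul_le_mul h1 hki01 (hnn _) (by positivity)
          _ = 1 := by rw [← zpow_add₀ hq0.ne']; simp
      · rw [habsFmul]
        exact mul_le_one₀ h2 (hnn _) hki11
    · intro h
      rw [habsFmul, habsFmul]
      exact ⟨(mul_le_of_le_one_left (hnn _) h).trans hk10, mul_le_one₀ h (hnn _) hk11⟩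
  have hone : absF 1 = 1 := by
    have h := habsFmul 1 1
    rw [mul_one] at h
    have h0 : absF 1 ≠ 0 := fun h => one_ne_zero ((habsF0 1).1 h)
    field_simp at h
    exact h.symm
  have hpow : ∀ m : ℕ, absF (ϖ ^ m) = q ^ (-(m : ℤ)) := by
    intro m
    induction m with
    | zero => simpa using hone
    | succ m ih =>
      rw [pow_succ, habsFmul, ih, hϖ, ← _root_.zpow_neg_one, ← zpow_add₀ hq0.ne']
      congr 1
      push_cast
      ring
  have hϖ0 : ϖ ≠ 0 := fun h => by
    rw [(habsF0 ϖ).2 h] at hϖ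
    exact (inv_pos.2 hq0).ne hϖ
  let A : ℕ → Set F := fun m => {x | absF x = q ^ (-(m : ℤ))}
  have hA : ∀ m, MeasurableSet (A m) := fun m => habsFmeas (measurableSet_singleton _)
  have hAμ : ∀ m, μ (A m) = 1 := by
    intro m
    have hmeas : Measurable (fun x : F => ϖ ^ m * x) :=
      hFmulmeas.comp (measurable_const.prodMk measurable_id)
    rw [← hμinv (ϖ ^ m) (pow_ne_zero _ hϖ0), Measure.map_apply hmeas (hA m), ← hμ1]
    congr 1
    ext x
    have hp : (0 : ℝ) < q ^ (-(m : ℤ)) := by positivity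
    simp only [A, Set.mem_preimage, Set.mem_ofPred_eq, habsFmul, hpow]
    exact mul_eq_left₀ hp.ne'
  set c : ℂ := (q : ℂ) ^ (-2 * s) with hc
  have hc1 : ‖c‖ < 1 := cnorm_aux q hq s hs
  let G : ℕ → F → ℂ := fun m => (A m).indicator (fun _ => c ^ m)
  have hGint : ∀ m, Integrable (G m) μ := fun m =>
    (integrable_indicator_iff (hA m)).2 (integrableOn_const (by simp [hAμ]) (by simp))
  have hGval : ∀ m, ∫ x, G m x ∂μ = c ^ m := by
    intro m
    simp only [G]
    rw [integral_indicator (hA m)]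
    simp [Measure.real, hAμ]
  have hGnorm : ∀ m, ∫ x, ‖G m x‖ ∂μ = ‖c‖ ^ m := by
    intro m
    simp only [G, norm_indicator_eq_indicator_norm]
    rw [integral_indicator (hA m)]
    simp [Measure.real, hAμ]
  have hsum := hasSum_integral_of_summable_integral_norm hGint
    (by simp only [hGnorm]; exact summable_geometric_of_lt_one (norm_nonneg _) hc1)
  simp only [hGval] at hsum
  have hz : zInt μ absF s k (PhiN q absF (n : ℤ)) = ∫ x, ∑' m, G m x ∂μ := by
    unfold zInt
    apply integral_congr_ae
    have h0 : ∀ᵐ x ∂μ, x ≠ 0 := by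
      rw [ae_iff]; simpa using hμ0
    filter_upwards [h0] with x hx
    simp only [PhiN, hcond]
    obtain ⟨j, hj⟩ := hvalF x hx
    have hinj : Function.Injective (fun i : ℤ => q ^ i) := zpow_right_injective₀ hq0 hq.ne'
    by_cases hj0 : j ≤ 0
    · obtain ⟨m, rfl⟩ : ∃ m : ℕ, j = -(m : ℤ) := ⟨j.natAbs, by omega⟩
      have hle : absF x ≤ 1 := by
        rw [hj]; exact zpow_le_one_of_nonpos₀ hq.le hj0
      rw [if_pos hle, one_mul, hj, cpow_aux q hq, tsum_eq_single m]
      · simp [G, A, hj, hc]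
      · intro i hi
        apply Set.indicator_of_notMem
        intro h
        have h' := hinj (hj.symm.trans h)
        omega
    · have hle : ¬ absF x ≤ 1 := by
        rw [hj, not_le]; exact one_lt_zpow₀ hq (by omega)
      rw [if_neg hle, zero_mul]
      symm
      convert tsum_zero with i
      apply Set.indicator_of_notMem
      intro h
      have h' := hinj (hj.symm.trans h)
      omega
  rw [hz, ← hsum.tsum_eq, tsum_geometric_of_norm_lt_one hc1, LEfac, one_div]
end
end

section
/- Let n be a non-negative integer. Then for every k ∈ K_{n,H} and every s ∈ ℂ with Re(s) > 0, f(s, k, Φ_n) = L_E(s,1) = 1/(1 − q^{-2s}). -/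
set_option autoImplicit false

open MeasureTheory Matrix

noncomputable section

/-- `t(a) = diag(a, conj(a)⁻¹)`. -/
def tdiag {E : Type} [Field E] (σ : E → E) (a : E) : Matrix (Fin 2) (Fin 2) E :=
  !![a, 0; 0, (σ a)⁻¹]

/-- `d(c) = diag(c, 1)`. -/
def ddiag {E : Type} [Field E] (c : E) : Matrix (Fin 2) (Fin 2) E := !![c, 0; 0, 1]

/-- `H = U(1,1)(E/F) = {h : ᵗh̄ J₂ h = J₂}` with `J₂` the 2×2 antidiagonal matrix. -/
def HsetM {E : Type} [Field E] (σ : E → E) : Set (Matrix (Fin 2) (Fin 2) E) :=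
  {m | (m.map σ)ᵀ * !![(0 : E), 1; 1, 0] * m = !![(0 : E), 1; 1, 0]}

/-- `U_H`, the upper triangular unipotent subgroup of `H`. -/
def UHsetM {E : Type} [Field E] (σ : E → E) : Set (Matrix (Fin 2) (Fin 2) E) :=
  {m | ∃ y : E, y + σ y = 0 ∧ m = !![1, y; 0, 1]}

/-- `K_{n,H} = {(a,b;c,d) ∈ H : a, d ∈ o_E, b ∈ p_E^{-n}, c ∈ p_E^n}`. -/
def KHset {E : Type} [Field E] (q : ℝ) (σ : E → E) (absE : E → ℝ) (n : ℤ) :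
    Set (Matrix (Fin 2) (Fin 2) E) :=
  {m | m ∈ HsetM σ ∧ absE (m 0 0) ≤ 1 ∧ absE (m 1 1) ≤ 1 ∧
    absE (m 0 1) ≤ (q ^ 2) ^ n ∧ absE (m 1 0) ≤ (q ^ 2) ^ (-n)}

/-- `h = t(b) d(√ε) h₁ d(√ε)⁻¹` is a decomposition of `h` with `b ∈ E^×` and
`h₁ ∈ SL₂(F)`. -/
def IsDecomp {F E : Type} [Field F] [Field E] [Algebra F E] (σ : E → E) (sqrtε : E)
    (b : E) (h₁ : Matrix (Fin 2) (Fin 2) F) (h : Matrix (Fin 2) (Fin 2) E) : Prop :=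
  b ≠ 0 ∧ h₁.det = 1 ∧
    h = tdiag σ b * ddiag sqrtε * h₁.map (algebraMap F E) * ddiag sqrtε⁻¹


theorem zint_aux (F : Type) [Field F] 
    (q : ℝ) (hq : 1 < q)
    (absF : F → ℝ)
    (habsF0 : ∀ x : F, absF x = 0 ↔ x = 0)
    (habsFmul : ∀ x y : F, absF (x * y) = absF x * absF y)
    (ϖ : F) (hϖ : absF ϖ = q⁻¹)
    (hvalF : ∀ x : F, x ≠ 0 → ∃ m : ℤ, absF x = q ^ m)
    [MeasurableSpace F]
    (habsFmeas : Measurable absF)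
    (hFmulmeas : Measurable fun p : F × F => p.1 * p.2)
    (μ : Measure F)
    (hμ0 : μ {0} = 0)
    (hμinv : ∀ a : F, a ≠ 0 → Measure.map (fun x => a * x) μ = μ)
    (hμ1 : μ {x : F | absF x = 1} = 1) (s : ℂ) (hs : 0 < s.re) :
    ∫ r, (if absF r ≤ 1 then (1:ℂ) else 0) * Complex.ofReal (absF r ^ 2) ^ s ∂μ
      = 1 / (1 - (q : ℂ) ^ (-2 * s)) := by
  have hq0 : 0 < q := by linarith
  have h1 : absF 1 = 1 := by
    have h := habsFmul 1 1
    have h' : absF 1 ≠ 0 := by simp [habsF0]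
    rw [mul_one] at h
    exact (mul_left_cancel₀ h' (by rw [mul_one]; exact h)).symm
  have hpow : ∀ m : ℕ, absF (ϖ ^ m) = (q ^ m)⁻¹ := by
    intro m
    induction m with
    | zero => simp [h1]
    | succ k ih => rw [pow_succ, habsFmul, ih, hϖ, pow_succ, mul_inv]
  have hϖ0 : ϖ ≠ 0 := by
    intro h
    have := (habsF0 ϖ).2 h
    rw [hϖ] at this
    exact (inv_ne_zero hq0.ne') this
  let S : ℕ → Set F := fun m => {x | absF x = (q ^ m)⁻¹}
  have hSm : ∀ m, MeasurableSet (S m) := fun m => habsFmeas (measurableSet_singleton _)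
  have hSμ : ∀ m, μ (S m) = 1 := by
    intro m
    have hmm : Measurable (fun x : F => ϖ ^ m * x) :=
      hFmulmeas.comp (measurable_const.prodMk measurable_id)
    rw [← hμinv (ϖ ^ m) (pow_ne_zero _ hϖ0), Measure.map_apply hmm (hSm m), ← hμ1]
    congr 1
    ext x
    have : (0:ℝ) < (q ^ m)⁻¹ := by positivity
    simp only [S, Set.mem_preimage, Set.mem_ofPred_eq, habsFmul, hpow]
    constructor
    · intro h
      exact mul_left_cancel₀ this.ne' (by rw [h, mul_one])
    · intro h; rw [h, mul_one]
  have hSd : Pairwise (Function.onFun Disjoint S) := by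
    intro i j hij
    refine Set.disjoint_left.2 fun x hi hj => hij ?_
    have : (q ^ i)⁻¹ = (q ^ j)⁻¹ := hi.symm.trans hj
    exact pow_right_injective₀ hq0 hq.ne' (inv_injective this)
  set f : F → ℂ := fun r => Complex.ofReal (absF r ^ 2) ^ s with hf
  set z : ℂ := (q : ℂ) ^ (-2 * s) with hz
  have hval : ∀ m, ∀ x ∈ S m, f x = z ^ m := by
    intro m x hx
    have hx' : absF x = (q ^ m)⁻¹ := hx
    simp only [hf, hx', hz]
    have hq1 : (q : ℂ) ≠ 0 := by exact_mod_cast hq0.ne'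
    rw [← Complex.cpow_nat_mul]
    have : ((((q ^ m)⁻¹ ^ 2 : ℝ)) : ℂ) = ((q ^ (-(2 * m : ℝ)) : ℝ) : ℂ) := by
      congr 1
      rw [Real.rpow_neg hq0.le, show (2 * m : ℝ) = ((m * 2 : ℕ) : ℝ) by push_cast; ring,
        Real.rpow_natCast, pow_mul, inv_pow]
    rw [this, Complex.ofReal_cpow hq0.le, ← Complex.ofReal_cpow hq0.le]
    rw [Complex.cpow_def_of_ne_zero (by
      have := Real.rpow_pos_of_pos hq0 (-(2 * m : ℝ)); exact_mod_cast this.ne'),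
      Complex.cpow_def_of_ne_zero hq1, ← Complex.ofReal_log (by positivity),
      Real.log_rpow hq0, ← Complex.ofReal_log hq0.le]
    congr 1
    push_cast
    ring
  have hznorm : ‖z‖ < 1 := by
    rw [hz, Complex.norm_cpow_eq_rpow_re_of_pos hq0]
    apply Real.rpow_lt_one_of_one_lt_of_neg hq
    simp [hs]
  have hset : ∀ m, ∫ r in S m, f r ∂μ = z ^ m := by
    intro m
    rw [setIntegral_congr_fun (hSm m) (hval m)]
    simp [Measure.real, hSμ]
  have hsetn : ∀ m, ∫ r in S m, ‖f r‖ ∂μ = ‖z‖ ^ m := by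
    intro m
    rw [setIntegral_congr_fun (g := fun _ => ‖z‖ ^ m) (hSm m)
      (fun x hx => by simp only [hval m x hx, norm_pow])]
    simp [Measure.real, hSμ]
  have hint : IntegrableOn f (⋃ m, S m) μ := by
    apply integrableOn_iUnion_of_summable_integral_norm
    · intro m
      rw [integrableOn_congr_fun (hval m) (hSm m)]
      simp [hSμ]
    · simp_rw [hsetn]
      exact summable_geometric_of_lt_one (norm_nonneg _) hznorm
  have hsum := integral_iUnion hSm hSd hint
  simp_rw [hset] at hsum
  rw [tsum_geometric_of_norm_lt_one hznorm] at hsum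
  rw [one_div, ← hsum, ← integral_indicator (MeasurableSet.iUnion hSm)]
  apply integral_congr_ae
  have h0 : ∀ᵐ x ∂μ, x ≠ 0 := by
    rw [ae_iff]; simpa using hμ0
  filter_upwards [h0] with x hx
  by_cases hU : x ∈ ⋃ m, S m
  · rw [Set.indicator_of_mem hU]
    obtain ⟨m, hm⟩ := Set.mem_iUnion.1 hU
    have hm' : absF x = (q ^ m)⁻¹ := hm
    have : absF x ≤ 1 := by rw [hm']; exact inv_le_one_of_one_le₀ (one_le_pow₀ hq.le)
    simp [this, hf]
  · rw [Set.indicator_of_notMem hU]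
    have : ¬ absF x ≤ 1 := by
      intro hle
      apply hU
      obtain ⟨m, hm⟩ := hvalF x hx
      rw [hm, zpow_le_one_iff_right₀ hq] at hle
      refine Set.mem_iUnion.2 ⟨m.natAbs, ?_⟩
      show absF x = _
      rw [hm, ← zpow_natCast, ← _root_.zpow_neg]
      congr 1
      omega
    simp [this]

/-- For every `k ∈ K_{n,H}` and `Re(s) > 0`, `f(s, k, Φ_n) = L_E(s, 1)`. -/
theorem stmt_2
    (F : Type) [Field F] [CharZero F]
    (q : ℝ) (hq : 1 < q)
    (absF : F → ℝ)
    (habsF0 : ∀ x : F, absF x = 0 ↔ x = 0)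
    (habsFmul : ∀ x y : F, absF (x * y) = absF x * absF y)
    (habsFadd : ∀ x y : F, absF (x + y) ≤ max (absF x) (absF y))
    (ϖ : F) (hϖ : absF ϖ = q⁻¹)
    (hvalF : ∀ x : F, x ≠ 0 → ∃ m : ℤ, absF x = q ^ m)
    (habsF2 : absF 2 = 1)
    [MeasurableSpace F]
    (habsFmeas : Measurable absF)
    (hFmulmeas : Measurable fun p : F × F => p.1 * p.2)
    (hFaddmeas : Measurable fun p : F × F => p.1 + p.2)
    (μ : Measure F) [SigmaFinite μ]
    (hμ0 : μ {0} = 0)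
    (hμinv : ∀ a : F, a ≠ 0 → Measure.map (fun x => a * x) μ = μ)
    (hμ1 : μ {x : F | absF x = 1} = 1)
    (E : Type) [Field E] [Algebra F E]
    (σ : E → E)
    (hσadd : ∀ x y : E, σ (x + y) = σ x + σ y)
    (hσmul : ∀ x y : E, σ (x * y) = σ x * σ y)
    (hσinvol : ∀ x : E, σ (σ x) = x)
    (hσfix : ∀ x : F, σ (algebraMap F E x) = algebraMap F E x)
    (ε : F) (sqrtε : E)
    (hεabs : absF ε = 1)
    (hεnonsq : ∀ a : F, a * a ≠ ε)
    (hsqrtε : sqrtε * sqrtε = algebraMap F E ε)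
    (hσsqrtε : σ sqrtε = -sqrtε)
    (hspan : ∀ x : E, ∃ a b : F, x = algebraMap F E a + algebraMap F E b * sqrtε)
    (absE : E → ℝ)
    (habsE0 : ∀ x : E, absE x = 0 ↔ x = 0)
    (habsEmul : ∀ x y : E, absE (x * y) = absE x * absE y)
    (habsEadd : ∀ x y : E, absE (x + y) ≤ max (absE x) (absE y))
    (habsEF : ∀ x : F, absE (algebraMap F E x) = absF x ^ 2)
    (habsEconj : ∀ x : E, absE (σ x) = absE x)
    (habsEspan : ∀ a b : F,
      absE (algebraMap F E a + algebraMap F E b * sqrtε) = max (absF a ^ 2) (absF b ^ 2))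
    (hvalE : ∀ x : E, x ≠ 0 → ∃ m : ℤ, absE x = (q ^ 2) ^ m)
    (fE : ℂ → Matrix (Fin 2) (Fin 2) E → (F × F → ℂ) → ℂ)
    (hfE : ∀ (s : ℂ) (h : Matrix (Fin 2) (Fin 2) E) (Φ : F × F → ℂ)
      (b : E) (h₁ : Matrix (Fin 2) (Fin 2) F), IsDecomp σ sqrtε b h₁ h →
      fE s h Φ = Complex.ofReal (absE b) ^ s * zInt μ absF s h₁ Φ)
    (n : ℕ)
    (k : Matrix (Fin 2) (Fin 2) E) (hk : k ∈ KHset q σ absE (n : ℤ))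
    (s : ℂ) (hs : 0 < s.re) :
    fE s k (PhiN q absF (n : ℤ)) = LEfac q s := by
  have hq0 : 0 < q := by linarith
  have hσ1 : σ 1 = 1 := by simpa using hσfix 1
  have hσ0 : σ 0 = 0 := by simpa using hσfix 0
  let φ : E →+* E :=
    { toFun := σ, map_one' := hσ1, map_zero' := hσ0, map_add' := hσadd, map_mul' := hσmul }
  have hσinv : ∀ x, σ x⁻¹ = (σ x)⁻¹ := fun x => map_inv₀ φ x
  have hσneg : ∀ x, σ (-x) = -σ x := fun x => map_neg φ x
  have hσne : ∀ x, x ≠ 0 → σ x ≠ 0 := fun x hx => (map_ne_zero φ).2 hx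
  have hF1 : absF 1 = 1 := by
    have h := habsFmul 1 1
    have h' : absF 1 ≠ 0 := by simp [habsF0]
    rw [mul_one] at h
    exact (mul_left_cancel₀ h' (by rw [mul_one]; exact h)).symm
  have hFnn : ∀ x, 0 ≤ absF x := by
    intro x
    by_cases hx : x = 0
    · rw [(habsF0 x).2 hx]
    · obtain ⟨m, hm⟩ := hvalF x hx
      rw [hm]; positivity
  have hEnn : ∀ x, 0 ≤ absE x := by
    intro x
    by_cases hx : x = 0
    · rw [(habsE0 x).2 hx]
    · obtain ⟨m, hm⟩ := hvalE x hx
      rw [hm]; positivity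
  have hE1 : absE 1 = 1 := by
    have := habsEF 1
    rw [map_one, hF1] at this
    simpa using this
  have hEinv : ∀ x, absE x⁻¹ = (absE x)⁻¹ := by
    intro x
    by_cases hx : x = 0
    · simp [hx, (habsE0 0).2 rfl]
    · apply eq_inv_of_mul_eq_one_left
      rw [← habsEmul, inv_mul_cancel₀ hx, hE1]
  have hEneg : ∀ x, absE (-x) = absE x := by
    intro x
    have h1 : absE (-1) * absE (-1) = 1 := by rw [← habsEmul]; simp [hE1]
    have h2 : absE (-1) = 1 := by nlinarith [hEnn (-1)]
    rw [← neg_one_mul, habsEmul, h2, one_mul]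
  have hEs : absE sqrtε = 1 := by
    have := habsEspan 0 1
    simpa [hF1, (habsF0 0).2 rfl] using this
  have hs0 : sqrtε ≠ 0 := by
    intro h
    rw [h, (habsE0 0).2 rfl] at hEs
    exact zero_ne_one hEs
  have h2E : (2 : E) ≠ 0 := by
    have h : algebraMap F E 2 ≠ 0 := (map_ne_zero _).2 two_ne_zero
    rwa [map_ofNat] at h
  have hdesc : ∀ x : E, σ x = x → ∃ a : F, x = algebraMap F E a := by
    intro x hx
    obtain ⟨a, b, hab⟩ := hspan x
    refine ⟨a, ?_⟩
    rw [hab, hσadd, hσmul, hσfix, hσfix, hσsqrtε] at hx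
    have h : 2 * (algebraMap F E b * sqrtε) = 0 := by linear_combination -hx
    have h' := (mul_eq_zero.1 h).resolve_left h2E
    rw [hab, h', add_zero]
  -- reduction to an explicit decomposition
  have fin : ∀ (β : E) (x y z w : F), β ≠ 0 → absE β = 1 →
      k 0 0 * β⁻¹ = algebraMap F E x → k 0 1 * β⁻¹ * sqrtε⁻¹ = algebraMap F E y →
      k 1 0 * σ β * sqrtε = algebraMap F E z → k 1 1 * σ β = algebraMap F E w →
      k 0 0 * β⁻¹ * (k 1 1 * σ β) - k 0 1 * β⁻¹ * (k 1 0 * σ β) = 1 →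
      (absE (k 1 1) = 1 ∨ absE (k 1 0) = (q ^ 2) ^ (-(n : ℤ))) →
      fE s k (PhiN q absF (n : ℤ)) = LEfac q s := by
    intro β x y z w hβ hβ1 hx hy hz hw hdet hor
    obtain ⟨-, -, hd, -, hc⟩ := hk
    have hQ : (0:ℝ) < q ^ (-(n : ℤ)) := by positivity
    have hQ2 : (q ^ 2) ^ (-(n : ℤ)) = (q ^ (-(n : ℤ))) ^ 2 := by
      rw [← zpow_natCast, ← zpow_natCast, ← _root_.zpow_mul, ← _root_.zpow_mul, mul_comm]
    have hzc : absF z ^ 2 = absE (k 1 0) := by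
      rw [← habsEF, ← hz, habsEmul, habsEmul, habsEconj, hβ1, hEs, mul_one, mul_one]
    have hwd : absF w ^ 2 = absE (k 1 1) := by
      rw [← habsEF, ← hw, habsEmul, habsEconj, hβ1, mul_one]
    rw [← hzc, ← hwd, hQ2] at hor
    rw [← hwd] at hd
    rw [← hzc, hQ2] at hc
    have hzle : absF z ≤ q ^ (-(n : ℤ)) := by
      exact (sq_le_sq₀ (hFnn _) hQ.le).1 hc
    have hwle : absF w ≤ 1 := by
      exact (sq_le_one_iff₀ (hFnn _)).1 hd
    have hr : ∀ r, (absF (r * z) ≤ q ^ (-(n : ℤ)) ∧ absF (r * w) ≤ 1) ↔ absF r ≤ 1 := by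
      intro r
      rw [habsFmul, habsFmul]
      constructor
      · rintro ⟨h1, h2⟩
        rcases hor with h | h
        · rw [(pow_eq_one_iff_of_nonneg (hFnn w) two_ne_zero).1 h, mul_one] at h2
          exact h2
        · rw [(sq_eq_sq₀ (hFnn _) hQ.le).1 h] at h1
          exact (mul_le_iff_le_one_left hQ).1 h1
      · intro h
        exact ⟨(mul_le_mul h hzle (hFnn _) zero_le_one).trans (one_mul _).le,
          mul_le_one₀ h (hFnn _) hwle⟩
    have hσβ := hσne β hβ
    have hdec : IsDecomp σ sqrtε β !![x, y; z, w] k := by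
      refine ⟨hβ, ?_, ?_⟩
      · apply (algebraMap F E).injective
        rw [det_fin_two_of, map_sub, map_mul, map_mul, map_one, ← hx, ← hy, ← hz, ← hw, ← hdet]
        field_simp
      · ext i j
        fin_cases i <;> fin_cases j <;>
          simp [tdiag, ddiag, Matrix.mul_apply, Matrix.vecMul, dotProduct, Fin.sum_univ_two, ← hx, ← hy, ← hz, ← hw] <;>
          field_simp
    rw [hfE s k _ β _ hdec, hβ1]
    have hz' := zint_aux F q hq absF habsF0 habsFmul ϖ hϖ hvalF habsFmeas hFmulmeas μ hμ0 hμinv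
      hμ1 s hs
    simp only [zInt, PhiN, LEfac]
    rw [← hz']
    rw [Complex.ofReal_one, Complex.one_cpow, one_mul]
    congr 1
    funext r
    congr 1
    exact if_congr (hr r) rfl rfl
  -- relations
  obtain ⟨hH, ha, hd, hb, hc⟩ := hk
  have hH1 : (k.map σ)ᵀ * !![(0 : E), 1; 1, 0] * k = !![(0 : E), 1; 1, 0] := hH
  have hJ : (!![(0 : E), 1; 1, 0]) * !![(0 : E), 1; 1, 0] = 1 := by
    ext i j; fin_cases i <;> fin_cases j <;> simp
  have hH2 : k * (!![(0 : E), 1; 1, 0] * ((k.map σ)ᵀ * !![(0 : E), 1; 1, 0])) = 1 := by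
    apply mul_eq_one_comm.1
    rw [Matrix.mul_assoc, hH1, hJ]
  have e01 := congrFun (congrFun hH1 0) 1
  have f00 := congrFun (congrFun hH2 0) 0
  have f01 := congrFun (congrFun hH2 0) 1
  have f10 := congrFun (congrFun hH2 1) 0
  have f11 := congrFun (congrFun hH2 1) 1
  have e00 := congrFun (congrFun hH1 0) 0
  have e11 := congrFun (congrFun hH1 1) 1
  simp [Matrix.mul_apply, Matrix.vecMul, dotProduct, Fin.sum_univ_two] at e00 e11 e01 f00 f01 f10 f11
  generalize k 0 0 = a at *
  generalize k 0 1 = b at *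
  generalize k 1 0 = c at *
  generalize k 1 1 = d at *
  clear hH hH1 hH2
  have hQ2 : (0:ℝ) < (q ^ 2) ^ (-(n : ℤ)) := by positivity
  have hbc : absE b * (q ^ 2) ^ (-(n : ℤ)) ≤ 1 := by
    rw [_root_.zpow_neg]
    exact mul_inv_le_one_of_le₀ hb (by positivity)
  have hor : absE d = 1 ∨ absE c = (q ^ 2) ^ (-(n : ℤ)) := by
    have h := habsEadd (σ c * b) (σ a * d)
    rw [e01, hE1, habsEmul, habsEmul, habsEconj, habsEconj] at h
    rcases le_max_iff.1 h with h | h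
    · right
      apply le_antisymm hc
      by_contra! hlt
      have hb0 : absE b ≠ 0 := by
        intro h0
        rw [h0, mul_zero] at h
        linarith
      have := mul_lt_mul_of_pos_right hlt (lt_of_le_of_ne (hEnn b) hb0.symm)
      linarith
    · left
      apply le_antisymm hd
      have := mul_le_mul_of_nonneg_right ha (hEnn d)
      linarith
  have hfix1 : σ a * d = a * σ d := by linear_combination e01 - f00
  by_cases hd1 : absE d = 1
  · have hd0 : d ≠ 0 := by
      intro h0
      rw [h0, (habsE0 0).2 rfl] at hd1
      exact zero_ne_one hd1
    have hσd := hσne d hd0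
    obtain ⟨x, hx⟩ := hdesc (a * (σ d)⁻¹⁻¹) (by
      simp only [hσmul, hσinv, hσinvol, inv_inv]; linear_combination hfix1)
    obtain ⟨y, hy⟩ := hdesc (b * (σ d)⁻¹⁻¹ * sqrtε⁻¹) (by
      simp only [hσmul, hσinv, hσinvol, inv_inv, hσsqrtε]
      field_simp
      linear_combination -e11)
    obtain ⟨z, hz⟩ := hdesc (c * σ (σ d)⁻¹ * sqrtε) (by
      simp only [hσmul, hσinv, hσinvol, hσsqrtε]
      field_simp
      linear_combination -f10)
    obtain ⟨w, hw⟩ := hdesc (d * σ (σ d)⁻¹) (by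
      simp only [hσmul, hσinv, hσinvol]
      field_simp)
    refine fin (σ d)⁻¹ x y z w (inv_ne_zero hσd) (by rw [hEinv, habsEconj, hd1, inv_one])
      hx hy hz hw ?_ hor
    simp only [hσinv, hσinvol, inv_inv]
    field_simp
    linear_combination d * f00 - b * f10
  · have hc1 := hor.resolve_left hd1
    have hc0 : c ≠ 0 := by
      intro h0
      rw [h0, (habsE0 0).2 rfl] at hc1
      exact hQ2.ne hc1
    have hσc := hσne c hc0
    have hpow : ∀ m : ℕ, absF (ϖ ^ m) = (q ^ m)⁻¹ := by
      intro m
      induction m with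
      | zero => simp [hF1]
      | succ k ih => rw [pow_succ, habsFmul, ih, hϖ, pow_succ, mul_inv]
    obtain ⟨Z, hZ⟩ : ∃ Z, Z = algebraMap F E (ϖ ^ n) := ⟨_, rfl⟩
    have hσZ : σ Z = Z := by rw [hZ, hσfix]
    have hZa : absE Z = (q ^ 2) ^ (-(n : ℤ)) := by
      rw [hZ, habsEF, hpow, _root_.zpow_neg, zpow_natCast, inv_pow, ← pow_mul, ← pow_mul, mul_comm]
    have hZ0 : Z ≠ 0 := by
      intro h0
      rw [h0, (habsE0 0).2 rfl] at hZa
      exact hQ2.ne hZa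
    obtain ⟨β, hβ⟩ : ∃ β, β = Z * (σ c * sqrtε)⁻¹ := ⟨_, rfl⟩
    have hσβ : σ β = -(Z * (c * sqrtε)⁻¹) := by
      rw [hβ, hσmul, hσinv, hσmul, hσinvol, hσZ, hσsqrtε, mul_neg, inv_neg, mul_neg]
    have hβ0 : β ≠ 0 := by
      rw [hβ]; exact mul_ne_zero hZ0 (inv_ne_zero (mul_ne_zero hσc hs0))
    have hβ1 : absE β = 1 := by
      rw [hβ, habsEmul, hEinv, habsEmul, habsEconj, hEs, hZa, hc1, mul_one,
        mul_inv_cancel₀ hQ2.ne']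
    obtain ⟨x, hx⟩ := hdesc (a * β⁻¹) (by
      rw [hσmul, hσinv, hσβ, hβ]
      field_simp
      linear_combination -e00)
    obtain ⟨y, hy⟩ := hdesc (b * β⁻¹ * sqrtε⁻¹) (by
      rw [hσmul, hσmul, hσinv, hσinv, hσβ, hβ, hσsqrtε]
      field_simp
      linear_combination f11 - e01)
    obtain ⟨z, hz⟩ := hdesc (c * σ β * sqrtε) (by
      rw [hσmul, hσmul, hσinvol, hσβ, hβ, hσsqrtε]
      field_simp)
    obtain ⟨w, hw⟩ := hdesc (d * σ β) (by
      rw [hσmul, hσinvol, hσβ, hβ]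
      field_simp
      linear_combination f10)
    refine fin β x y z w hβ0 hβ1 hx hy hz hw ?_ hor
    rw [hσβ, hβ]
    field_simp
    linear_combination c * f00 - a * f10
end
end

section
/- Let n be a non-negative integer and let W: H → ℂ be a function that is left-invariant under U_H and right-invariant under K_{n,H}. Let s ∈ ℂ with Re(s) > 0 be such that ∫_{E^×} |W(t(a))|·|a|_E^{Re(s)−1} d^×a < ∞. Then Z(s, W, Φ_n) = Z(s, W)·L_E(s,1), where Z(s,W,Φ_n) = ∫_{E^×} ∫_{K_{n,H}} W(t(a)k)·f(s, t(a)k, Φ_n)·|a|_E^{-1} d^×a dk and Z(s,W) = ∫_{E^×} W(t(a))·|a|_E^{s−1} d^×a. -/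
set_option autoImplicit false

open MeasureTheory Matrix

noncomputable section

theorem aux_shell (F : Type) [Field F] (q : ℝ) (hq : 1 < q) (absF : F → ℝ)
    (habsF0 : ∀ x : F, absF x = 0 ↔ x = 0)
    (habsFmul : ∀ x y : F, absF (x * y) = absF x * absF y)
    (ϖ : F) (hϖ : absF ϖ = q⁻¹)
    [MeasurableSpace F]
    (habsFmeas : Measurable absF)
    (hFmulmeas : Measurable fun p : F × F => p.1 * p.2)
    (μ : Measure F)
    (hμinv : ∀ a : F, a ≠ 0 → Measure.map (fun x => a * x) μ = μ)
    (hμ1 : μ {x : F | absF x = 1} = 1) (j : ℤ) :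
    μ {x : F | absF x = q ^ (-j)} = 1 := by
  have hq0 : q ≠ 0 := by positivity
  have hϖ0 : ϖ ≠ 0 := by
    intro h
    rw [(habsF0 ϖ).2 h] at hϖ
    exact (inv_ne_zero hq0) hϖ.symm
  have h1 : absF 1 = 1 := by
    have h := habsFmul 1 1
    rw [mul_one] at h
    have h2 : absF 1 ≠ 0 := fun h => one_ne_zero ((habsF0 1).1 h)
    exact (mul_eq_left₀ h2).1 h.symm
  let φ : F →*₀ ℝ := { toFun := absF, map_zero' := (habsF0 0).2 rfl, map_one' := h1, map_mul' := habsFmul }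
  have hpow : absF (ϖ ^ j) = q ^ (-j) := by
    have := map_zpow₀ φ ϖ j
    change absF (ϖ ^ j) = (absF ϖ) ^ j at this
    rw [this, hϖ, _root_.inv_zpow, _root_.zpow_neg]
  have hm : Measurable (fun x : F => ϖ ^ j * x) :=
    hFmulmeas.comp (measurable_const.prodMk measurable_id)
  have := hμinv (ϖ ^ j) (zpow_ne_zero _ hϖ0)
  have hms : MeasurableSet {x : F | absF x = q ^ (-j)} := habsFmeas (measurableSet_singleton _)
  rw [← this, Measure.map_apply hm hms, ← hμ1]
  congr 1
  ext x
  have hp : q ^ (-j) ≠ 0 := zpow_ne_zero _ hq0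
  simp only [Set.mem_preimage, Set.mem_setOf_eq, habsFmul, hpow]
  exact mul_eq_left₀ hp

theorem aux_pow (q : ℝ) (hq : 1 < q) (s : ℂ) (j : ℤ) :
    (((q ^ 2) ^ j : ℝ) : ℂ) ^ s = ((q : ℂ) ^ (2 * s)) ^ j := by
  have hq0 : 0 < q := by positivity
  have hqC : (q : ℂ) ≠ 0 := by exact_mod_cast hq0.ne'
  have hx : 0 < (q ^ 2) ^ j := by positivity
  have hxC : (((q ^ 2) ^ j : ℝ) : ℂ) ≠ 0 := by exact_mod_cast hx.ne'
  rw [Complex.cpow_def_of_ne_zero hxC, Complex.cpow_def_of_ne_zero hqC, ← Complex.exp_int_mul,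
    ← Complex.ofReal_log hx.le, ← Complex.ofReal_log hq0.le, Real.log_zpow, Real.log_pow]
  congr 1
  push_cast
  ring

theorem aux_mat {E : Type} [Field E] (σ : E → E) (b e : E) (M : Matrix (Fin 2) (Fin 2) E) :
    tdiag σ b * ddiag e * M * ddiag e⁻¹ =
      !![b * e * M 0 0 * e⁻¹, b * e * M 0 1; (σ b)⁻¹ * M 1 0 * e⁻¹, (σ b)⁻¹ * M 1 1] := by
  rw [Matrix.eta_fin_two M]
  simp [tdiag, ddiag, Matrix.mul_fin_two]

theorem aux_int (F : Type) [Field F] (q : ℝ) (hq : 1 < q) (absF : F → ℝ)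
    (habsF0 : ∀ x : F, absF x = 0 ↔ x = 0)
    (habsFmul : ∀ x y : F, absF (x * y) = absF x * absF y)
    (ϖ : F) (hϖ : absF ϖ = q⁻¹)
    (hvalF : ∀ x : F, x ≠ 0 → ∃ m : ℤ, absF x = q ^ m)
    [MeasurableSpace F]
    (habsFmeas : Measurable absF)
    (hFmulmeas : Measurable fun p : F × F => p.1 * p.2)
    (μ : Measure F) (hμ0 : μ {0} = 0)
    (hμinv : ∀ a : F, a ≠ 0 → Measure.map (fun x => a * x) μ = μ)
    (hμ1 : μ {x : F | absF x = 1} = 1) (s : ℂ) (hs : 0 < s.re) (m : ℤ) :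
    ∫ r, (if absF r ≤ q ^ (-m) then (1:ℂ) else 0) * Complex.ofReal (absF r ^ 2) ^ s ∂μ
      = ((q : ℂ) ^ (-2 * s)) ^ m * LEfac q s := by
  have hq0 : 0 < q := by positivity
  have hqC : (q : ℂ) ≠ 0 := by exact_mod_cast hq0.ne'
  set f : F → ℂ := fun r => Complex.ofReal (absF r ^ 2) ^ s with hf
  let S : ℕ → Set F := fun i => {x : F | absF x = q ^ (-(m + i : ℤ))}
  set z : ℂ := (q : ℂ) ^ (-2 * s) with hz
  have hz0 : z ≠ 0 := by simp [hz, Complex.cpow_eq_zero_iff, hqC]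
  have hznorm : ‖z‖ < 1 := by
    rw [hz, Complex.norm_cpow_eq_rpow_re_of_pos hq0]
    apply Real.rpow_lt_one_of_one_lt_of_neg hq
    simp; exact hs
  have hSm : ∀ i, MeasurableSet (S i) := fun i => habsFmeas (measurableSet_singleton _)
  have hS1 : ∀ i, μ (S i) = 1 := fun i =>
    aux_shell F q hq absF habsF0 habsFmul ϖ hϖ habsFmeas hFmulmeas μ hμinv hμ1 _
  have hfS : ∀ i, ∀ x ∈ S i, f x = z ^ m * z ^ i := by
    intro i x hx
    have hx' : absF x = q ^ (-(m + i : ℤ)) := hx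
    have h2 : absF x ^ 2 = (q ^ 2) ^ (-(m + i : ℤ)) := by
      rw [hx', ← zpow_natCast, ← zpow_natCast, ← _root_.zpow_mul, ← _root_.zpow_mul, mul_comm]
    simp only [hf]
    rw [h2, aux_pow q hq, _root_.zpow_neg, ← _root_.inv_zpow, ← Complex.cpow_neg, ← neg_mul, ← hz,
      zpow_add₀ hz0, zpow_natCast]
  have hdisj : Pairwise (Function.onFun Disjoint S) := by
    intro i j hij
    refine Set.disjoint_left.2 fun x hx hy => hij ?_
    have h : q ^ (-(m + i : ℤ)) = q ^ (-(m + j : ℤ)) := hx.symm.trans hy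
    have := zpow_right_injective₀ hq0 hq.ne' h
    omega
  have hintn : ∀ i, IntegrableOn f (S i) μ := by
    intro i
    rw [integrableOn_congr_fun (hfS i) (hSm i)]
    exact integrableOn_const (by rw [hS1]; simp)
  have hint : IntegrableOn f (⋃ i, S i) μ := by
    apply integrableOn_iUnion_of_summable_integral_norm hintn
    have : ∀ i, ∫ x in S i, ‖f x‖ ∂μ = ‖z ^ m‖ * ‖z‖ ^ i := by
      intro i
      rw [setIntegral_congr_fun (g := fun _ => ‖z ^ m‖ * ‖z‖ ^ i) (hSm i)]
      · simp [measureReal_def, hS1]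
      · intro x hx
        simp only [hfS i x hx, norm_mul, norm_pow]
    simp_rw [this]
    exact (summable_geometric_of_lt_one (norm_nonneg _) hznorm).mul_left _
  have hsum := hasSum_integral_iUnion hSm hdisj hint
  have heach : ∀ i, ∫ x in S i, f x ∂μ = z ^ m * z ^ i := by
    intro i
    rw [setIntegral_congr_fun (hSm i) (hfS i)]
    simp [measureReal_def, hS1]
  simp_rw [heach] at hsum
  have hgeo := (hasSum_geometric_of_norm_lt_one hznorm).mul_left (z ^ m)
  have hU : ∫ x in ⋃ i, S i, f x ∂μ = z ^ m * LEfac q s := by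
    rw [hsum.unique hgeo, LEfac, one_div]
  rw [← hU, ← integral_indicator (MeasurableSet.iUnion hSm)]
  apply integral_congr_ae
  have hne : ∀ᵐ r ∂μ, r ≠ 0 := by
    rw [ae_iff]; simpa using hμ0
  filter_upwards [hne] with r hr
  obtain ⟨t, ht⟩ := hvalF r hr
  have hiff : absF r ≤ q ^ (-m) ↔ r ∈ ⋃ i, S i := by
    simp only [Set.mem_iUnion, S, Set.mem_setOf_eq, ht, zpow_le_zpow_iff_right₀ hq]
    constructor
    · intro h
      exact ⟨(-m - t).toNat, by congr 1; omega⟩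
    · rintro ⟨i, hi⟩
      have := zpow_right_injective₀ hq0 hq.ne' hi
      omega
  by_cases h : r ∈ ⋃ i, S i
  · rw [Set.indicator_of_mem h, if_pos (hiff.2 h), one_mul]
  · rw [Set.indicator_of_notMem h, if_neg (fun h' => h (hiff.1 h')), zero_mul]

theorem aux_decomp (F E : Type) [Field F] [CharZero F] [Field E] [Algebra F E]
    (σ : E → E)
    (hσadd : ∀ x y : E, σ (x + y) = σ x + σ y)
    (hσmul : ∀ x y : E, σ (x * y) = σ x * σ y)
    (hσinvol : ∀ x : E, σ (σ x) = x)
    (hσfix : ∀ x : F, σ (algebraMap F E x) = algebraMap F E x)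
    (sqrtε : E) (hs0 : sqrtε ≠ 0)
    (hσsqrtε : σ sqrtε = -sqrtε)
    (hspan : ∀ x : E, ∃ a b : F, x = algebraMap F E a + algebraMap F E b * sqrtε)
    (A B C D : E) (h1 : σ A * C + σ C * A = 0) (h2 : σ A * D + σ C * B = 1)
    (h3 : σ B * C + σ D * A = 1) (h4 : σ B * D + σ D * B = 0) :
    ∃ (b : E) (h₁ : Matrix (Fin 2) (Fin 2) F), IsDecomp σ sqrtε b h₁ !![A, B; C, D] := by
  have hσ0 : σ 0 = 0 := by simpa using hσfix 0
  have hσ1 : σ 1 = 1 := by simpa using hσfix 1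
  let τ : E →+* E := { toFun := σ, map_zero' := hσ0, map_one' := hσ1, map_mul' := hσmul, map_add' := hσadd }
  have hσinv : ∀ x, σ x⁻¹ = (σ x)⁻¹ := fun x => map_inv₀ τ x
  have hσne : ∀ x, x ≠ 0 → σ x ≠ 0 := fun x hx => (map_ne_zero τ).2 hx
  have hσneg : ∀ x, σ (-x) = -σ x := fun x => map_neg τ x
  have h2E : (2 : E) ≠ 0 := by
    have h : algebraMap F E 2 ≠ 0 := (map_ne_zero _).2 two_ne_zero
    rwa [map_ofNat] at h
  have hfixed : ∀ x : E, σ x = x → ∃ a : F, algebraMap F E a = x := by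
    intro x hx
    obtain ⟨a, b, rfl⟩ := hspan x
    rw [hσadd, hσmul, hσfix, hσfix, hσsqrtε] at hx
    have : 2 * (algebraMap F E b * sqrtε) = 0 := by linear_combination -hx
    refine ⟨a, ?_⟩
    rcases mul_eq_zero.1 this with h | h
    · exact absurd h h2E
    · rw [h, add_zero]
  have hinj := (algebraMap F E).injective
  by_cases hA : A = 0
  · subst hA
    rw [hσ0] at h1 h2
    have hB : B ≠ 0 := by
      rintro rfl
      simp at h2
    have hσB := hσne B hB
    obtain ⟨d, hd⟩ := hfixed (-(σ B * D * sqrtε⁻¹)) (by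
      rw [hσneg, hσmul, hσmul, hσinv, hσsqrtε, hσinvol, inv_neg]
      linear_combination sqrtε⁻¹ * h4)
    refine ⟨B * sqrtε⁻¹, !![0, 1; -1, d], mul_ne_zero hB (inv_ne_zero hs0), by simp [Matrix.det_fin_two], ?_⟩
    rw [aux_mat]
    ext i j
    fin_cases i <;> fin_cases j <;>
      simp [hd, hσmul, hσinv, hσsqrtε] <;>
      field_simp
    linear_combination h3
  · have hσA := hσne A hA
    have h5 : σ B * A + σ A * B = 0 := by
      have hh : σ B * A + σ A * B = 0 := by
        linear_combination A * σ A * h4 - σ B * A * h2 - σ A * B * h3 + B * σ B * h1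
      exact hh
    obtain ⟨x, hx⟩ := hfixed (B * A⁻¹ * sqrtε⁻¹) (by
      rw [hσmul, hσmul, hσinv, hσinv, hσsqrtε]
      field_simp
      linear_combination -h5)
    obtain ⟨y, hy⟩ := hfixed (sqrtε * σ A * C) (by
      rw [hσmul, hσmul, hσsqrtε, hσinvol]
      linear_combination -sqrtε * h1)
    refine ⟨A, !![1, x; y, 1 + x * y], hA, by simp [Matrix.det_fin_two], ?_⟩
    rw [aux_mat]
    ext i j
    fin_cases i <;> fin_cases j <;>
      simp [hx, hy] <;>
      field_simp
    linear_combination A * h2 - B * h1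

/-- If `W` is left `U_H`-invariant, right `K_{n,H}`-invariant, `Re(s) > 0` and
`∫_{E^×} |W(t(a))| |a|_E^{Re(s)-1} d^×a < ∞`, then `Z(s, W, Φ_n) = Z(s, W) L_E(s, 1)`,
where `Z(s, W, Φ_n)` is written in Iwasawa coordinates. -/
theorem stmt_3
    (F : Type) [Field F] [CharZero F]
    (q : ℝ) (hq : 1 < q)
    (absF : F → ℝ)
    (habsF0 : ∀ x : F, absF x = 0 ↔ x = 0)
    (habsFmul : ∀ x y : F, absF (x * y) = absF x * absF y)
    (habsFadd : ∀ x y : F, absF (x + y) ≤ max (absF x) (absF y))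
    (ϖ : F) (hϖ : absF ϖ = q⁻¹)
    (hvalF : ∀ x : F, x ≠ 0 → ∃ m : ℤ, absF x = q ^ m)
    (habsF2 : absF 2 = 1)
    [MeasurableSpace F]
    (habsFmeas : Measurable absF)
    (hFmulmeas : Measurable fun p : F × F => p.1 * p.2)
    (hFaddmeas : Measurable fun p : F × F => p.1 + p.2)
    (μ : Measure F) [SigmaFinite μ]
    (hμ0 : μ {0} = 0)
    (hμinv : ∀ a : F, a ≠ 0 → Measure.map (fun x => a * x) μ = μ)
    (hμ1 : μ {x : F | absF x = 1} = 1)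
    (E : Type) [Field E] [Algebra F E]
    (σ : E → E)
    (hσadd : ∀ x y : E, σ (x + y) = σ x + σ y)
    (hσmul : ∀ x y : E, σ (x * y) = σ x * σ y)
    (hσinvol : ∀ x : E, σ (σ x) = x)
    (hσfix : ∀ x : F, σ (algebraMap F E x) = algebraMap F E x)
    (ε : F) (sqrtε : E)
    (hεabs : absF ε = 1)
    (hεnonsq : ∀ a : F, a * a ≠ ε)
    (hsqrtε : sqrtε * sqrtε = algebraMap F E ε)
    (hσsqrtε : σ sqrtε = -sqrtε)
    (hspan : ∀ x : E, ∃ a b : F, x = algebraMap F E a + algebraMap F E b * sqrtε)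
    (absE : E → ℝ)
    (habsE0 : ∀ x : E, absE x = 0 ↔ x = 0)
    (habsEmul : ∀ x y : E, absE (x * y) = absE x * absE y)
    (habsEadd : ∀ x y : E, absE (x + y) ≤ max (absE x) (absE y))
    (habsEF : ∀ x : F, absE (algebraMap F E x) = absF x ^ 2)
    (habsEconj : ∀ x : E, absE (σ x) = absE x)
    (habsEspan : ∀ a b : F,
      absE (algebraMap F E a + algebraMap F E b * sqrtε) = max (absF a ^ 2) (absF b ^ 2))
    (hvalE : ∀ x : E, x ≠ 0 → ∃ m : ℤ, absE x = (q ^ 2) ^ m)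
    [MeasurableSpace E]
    (habsEmeas : Measurable absE) (hσmeas : Measurable σ)
    (hEmulmeas : Measurable fun p : E × E => p.1 * p.2)
    (μE : Measure E) [SigmaFinite μE]
    (hμE0 : μE {0} = 0)
    (hμEinv : ∀ a : E, a ≠ 0 → Measure.map (fun x => a * x) μE = μE)
    (hμE1 : μE {x : E | absE x = 1} = 1)
    (n : ℕ)
    [MeasurableSpace (Matrix (Fin 2) (Fin 2) E)]
    (κ : Measure (Matrix (Fin 2) (Fin 2) E)) [SigmaFinite κ]
    (hκmeas : MeasurableSet (KHset q σ absE (n : ℤ)))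
    (hκ1 : κ (KHset q σ absE (n : ℤ)) = 1)
    (hκcompl : κ ((KHset q σ absE (n : ℤ))ᶜ) = 0)
    (fE : ℂ → Matrix (Fin 2) (Fin 2) E → (F × F → ℂ) → ℂ)
    (hfE : ∀ (s : ℂ) (h : Matrix (Fin 2) (Fin 2) E) (Φ : F × F → ℂ)
      (b : E) (h₁ : Matrix (Fin 2) (Fin 2) F), IsDecomp σ sqrtε b h₁ h →
      fE s h Φ = Complex.ofReal (absE b) ^ s * zInt μ absF s h₁ Φ)
    (W : Matrix (Fin 2) (Fin 2) E → ℂ)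
    (hWU : ∀ u ∈ UHsetM σ, ∀ h ∈ HsetM σ, W (u * h) = W h)
    (hWK : ∀ h ∈ HsetM σ, ∀ k ∈ KHset q σ absE (n : ℤ), W (h * k) = W h)
    (s : ℂ) (hs : 0 < s.re)
    (hWmeas : AEStronglyMeasurable (fun a : E => W (tdiag σ a)) μE)
    (hWconv : Integrable (fun a : E => ‖W (tdiag σ a)‖ * absE a ^ (s.re - 1)) μE) :
    (∫ a : E, (∫ k, W (tdiag σ a * k) *
        fE s (tdiag σ a * k) (PhiN q absF (n : ℤ)) ∂κ) *
        Complex.ofReal ((absE a)⁻¹) ∂μE)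
      = (∫ a : E, W (tdiag σ a) * Complex.ofReal (absE a) ^ (s - 1) ∂μE) * LEfac q s := by
  have hq0 : 0 < q := by positivity
  have hs0' : s ≠ 0 := by rintro rfl; simp at hs
  have hFnn : ∀ x, 0 ≤ absF x := by
    intro x
    by_cases hx : x = 0
    · rw [(habsF0 x).2 hx]
    · obtain ⟨m, hm⟩ := hvalF x hx
      rw [hm]; positivity
  have hEnn : ∀ x, 0 ≤ absE x := by
    intro x
    by_cases hx : x = 0
    · rw [(habsE0 x).2 hx]
    · obtain ⟨m, hm⟩ := hvalE x hx
      rw [hm]; positivity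
  have hF0 : absF 0 = 0 := (habsF0 0).2 rfl
  have hF1 : absF 1 = 1 := by
    have h := habsFmul 1 1
    rw [mul_one] at h
    have h2 : absF 1 ≠ 0 := fun h => one_ne_zero ((habsF0 1).1 h)
    exact (mul_eq_left₀ h2).1 h.symm
  have hE1 : absE 1 = 1 := by
    have h := habsEF 1
    rw [map_one, hF1] at h
    simpa using h
  have hsq : absE sqrtε = 1 := by
    have h := habsEspan 0 1
    simpa [hF0, hF1] using h
  have hsq0 : sqrtε ≠ 0 := by
    intro h
    rw [(habsE0 _).2 h] at hsq
    exact zero_ne_one hsq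
  have hσ0 : σ 0 = 0 := by simpa using hσfix 0
  have hσ1 : σ 1 = 1 := by simpa using hσfix 1
  let τ : E →+* E := { toFun := σ, map_zero' := hσ0, map_one' := hσ1, map_mul' := hσmul, map_add' := hσadd }
  have hσinv : ∀ x, σ x⁻¹ = (σ x)⁻¹ := fun x => map_inv₀ τ x
  have hσne : ∀ x, x ≠ 0 → σ x ≠ 0 := fun x hx => (map_ne_zero τ).2 hx
  have htH : ∀ a : E, a ≠ 0 → tdiag σ a ∈ HsetM σ := by
    intro a ha
    have := hσne a ha
    show _ = _
    ext i j
    fin_cases i <;> fin_cases j <;>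
      simp [tdiag, Matrix.mul_apply, Fin.sum_univ_two, hσ0, hσinv, hσinvol, ha, this]
  have key : ∀ a : E, a ≠ 0 → ∀ k ∈ KHset q σ absE (n : ℤ),
      fE s (tdiag σ a * k) (PhiN q absF (n : ℤ)) = Complex.ofReal (absE a) ^ s * LEfac q s := by
    intro a ha k hk
    obtain ⟨hkH, hkA, hkD, hkB, hkC⟩ := hk
    have e := fun i j => congrFun (congrFun hkH i) j
    have e00 := e 0 0
    have e01 := e 0 1
    have e10 := e 1 0
    have e11 := e 1 1
    simp [Matrix.mul_apply, Fin.sum_univ_two] at e00 e01 e10 e11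
    have hkeq : k = !![k 0 0, k 0 1; k 1 0, k 1 1] := Matrix.eta_fin_two k
    obtain ⟨b, h₁, hb, hdet, hdec⟩ := aux_decomp F E σ hσadd hσmul hσinvol hσfix sqrtε hsq0 hσsqrtε hspan
      (k 0 0) (k 0 1) (k 1 0) (k 1 1) (by linear_combination e00) (by linear_combination e01)
      (by linear_combination e10) (by linear_combination e11)
    rw [← hkeq] at hdec
    have hdec' : IsDecomp σ sqrtε (a * b) h₁ (tdiag σ a * k) := by
      refine ⟨mul_ne_zero ha hb, hdet, ?_⟩
      have : tdiag σ (a * b) = tdiag σ a * tdiag σ b := by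
        ext i j
        fin_cases i <;> fin_cases j <;>
          simp [tdiag, Matrix.mul_apply, Fin.sum_univ_two, hσmul, mul_comm]
      rw [this]
      conv_lhs => rw [hdec]
      simp only [Matrix.mul_assoc]
    rw [hfE _ _ _ _ _ hdec']
    obtain ⟨m, hm⟩ := hvalE b hb
    have hσb := hσne b hb
    have hC : sqrtε * σ b * k 1 0 = algebraMap F E (h₁ 1 0) := by
      rw [hdec, aux_mat]
      simp
      field_simp
    have hD : σ b * k 1 1 = algebraMap F E (h₁ 1 1) := by
      rw [hdec, aux_mat]
      simp
      field_simp
    have hC' : (q ^ 2) ^ m * absE (k 1 0) = absF (h₁ 1 0) ^ 2 := by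
      rw [← habsEF, ← hC, habsEmul, habsEmul, hsq, habsEconj, hm, one_mul]
    have hD' : (q ^ 2) ^ m * absE (k 1 1) = absF (h₁ 1 1) ^ 2 := by
      rw [← habsEF, ← hD, habsEmul, habsEconj, hm]
    have hmax : absE (k 1 1) = 1 ∨ absE (k 1 0) = (q ^ 2) ^ (-(n : ℤ)) := by
      by_contra! hcon
      have hDlt := lt_of_le_of_ne hkD hcon.1
      have hClt := lt_of_le_of_ne hkC hcon.2
      have h2 : σ (k 0 0) * k 1 1 + σ (k 1 0) * k 0 1 = 1 := by linear_combination e01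
      have h3 := habsEadd (σ (k 0 0) * k 1 1) (σ (k 1 0) * k 0 1)
      rw [h2, hE1, habsEmul, habsEmul, habsEconj, habsEconj] at h3
      have h4 : absE (k 0 0) * absE (k 1 1) < 1 :=
        lt_of_le_of_lt (mul_le_of_le_one_left (hEnn _) hkA) hDlt
      have h5 : absE (k 1 0) * absE (k 0 1) < 1 := by
        have hp : (0:ℝ) < (q ^ 2) ^ (n : ℤ) := by positivity
        calc absE (k 1 0) * absE (k 0 1) ≤ absE (k 1 0) * (q ^ 2) ^ (n : ℤ) :=
              mul_le_mul_of_nonneg_left hkB (hEnn _)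
          _ < (q ^ 2) ^ (-(n : ℤ)) * (q ^ 2) ^ (n : ℤ) := mul_lt_mul_of_pos_right hClt hp
          _ = 1 := by rw [_root_.zpow_neg, inv_mul_cancel₀ hp.ne']
      exact absurd h3 (not_le.2 (max_lt h4 h5))
    have hq2 : ∀ j : ℤ, (q ^ 2) ^ j = (q ^ j) ^ 2 := by
      intro j
      rw [← zpow_natCast, ← zpow_natCast, ← _root_.zpow_mul, ← _root_.zpow_mul, mul_comm]
    have hqm : 0 < q ^ m := by positivity
    have hDle : absF (h₁ 1 1) ≤ q ^ m := by
      apply (sq_le_sq₀ (hFnn _) hqm.le).1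
      rw [← hD', ← hq2]
      exact mul_le_of_le_one_right (by positivity) hkD
    have hCle : absF (h₁ 1 0) ≤ q ^ m * q ^ (-(n : ℤ)) := by
      apply (sq_le_sq₀ (hFnn _) (by positivity)).1
      rw [← hC', mul_pow, ← hq2, ← hq2]
      exact mul_le_mul_of_nonneg_left hkC (by positivity)
    have hmax' : absF (h₁ 1 1) = q ^ m ∨ absF (h₁ 1 0) = q ^ m * q ^ (-(n : ℤ)) := by
      rcases hmax with h | h
      · left
        rw [h, mul_one, hq2] at hD'
        exact ((sq_eq_sq₀ (hFnn _) hqm.le).1 hD'.symm)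
      · right
        rw [h, hq2, hq2, ← mul_pow] at hC'
        exact ((sq_eq_sq₀ (hFnn _) (by positivity)).1 hC'.symm)
    have hcond : ∀ r : F, (absF (r * h₁ 1 0) ≤ q ^ (-(n : ℤ)) ∧ absF (r * h₁ 1 1) ≤ 1) ↔
        absF r ≤ q ^ (-m) := by
      intro r
      have hqn : 0 < q ^ (-(n : ℤ)) := by positivity
      have hre : absF r ≤ q ^ (-m) ↔ absF r * q ^ m ≤ 1 := by
        rw [_root_.zpow_neg, ← one_div, le_div_iff₀ hqm]
      rw [habsFmul, habsFmul, hre]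
      constructor
      · rintro ⟨hc, hd⟩
        rcases hmax' with h | h
        · rwa [h] at hd
        · rw [h, ← mul_assoc] at hc
          exact (mul_le_iff_le_one_left hqn).1 hc
      · intro h
        constructor
        · calc absF r * absF (h₁ 1 0) ≤ absF r * (q ^ m * q ^ (-(n : ℤ))) :=
                mul_le_mul_of_nonneg_left hCle (hFnn _)
            _ = (absF r * q ^ m) * q ^ (-(n : ℤ)) := by ring
            _ ≤ _ := mul_le_of_le_one_left hqn.le h
        · exact (mul_le_mul_of_nonneg_left hDle (hFnn _)).trans h
    have hz : zInt μ absF s h₁ (PhiN q absF (n : ℤ)) = ((q : ℂ) ^ (-2 * s)) ^ m * LEfac q s := by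
      rw [← aux_int F q hq absF habsF0 habsFmul ϖ hϖ hvalF habsFmeas hFmulmeas μ hμ0 hμinv hμ1 s hs m]
      simp only [zInt, PhiN, hcond]
    have hqC : (q : ℂ) ≠ 0 := by exact_mod_cast hq0.ne'
    have hqs : (q : ℂ) ^ (2 * s) ≠ 0 := by simp [Complex.cpow_eq_zero_iff, hqC]
    rw [hz, habsEmul, Complex.ofReal_mul, Complex.mul_cpow_ofReal_nonneg (hEnn _) (hEnn _), hm,
      aux_pow q hq, neg_mul, Complex.cpow_neg, _root_.inv_zpow]
    have := zpow_ne_zero m hqs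
    field_simp
  rw [← integral_mul_const]
  apply integral_congr_ae
  have hne : ∀ᵐ r ∂μE, r ≠ 0 := by
    rw [ae_iff]; simpa using hμE0
  have hκu : κ Set.univ = 1 := by
    rw [← measure_add_measure_compl hκmeas, hκ1, hκcompl, add_zero]
  filter_upwards [hne] with a ha
  have hin : ∫ k, W (tdiag σ a * k) * fE s (tdiag σ a * k) (PhiN q absF (n : ℤ)) ∂κ
      = W (tdiag σ a) * (Complex.ofReal (absE a) ^ s * LEfac q s) := by
    have hae : ∀ᵐ k ∂κ, k ∈ KHset q σ absE (n : ℤ) := by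
      rw [ae_iff]; exact hκcompl
    have : (fun k => W (tdiag σ a * k) * fE s (tdiag σ a * k) (PhiN q absF (n : ℤ))) =ᵐ[κ]
        fun _ => W (tdiag σ a) * (Complex.ofReal (absE a) ^ s * LEfac q s) := by
      filter_upwards [hae] with k hk
      rw [hWK _ (htH a ha) k hk, key a ha k hk]
    rw [integral_congr_ae this]
    simp [measureReal_def, hκu]
  have haE : (absE a : ℂ) ≠ 0 := by
    intro h
    exact ha ((habsE0 a).1 (by exact_mod_cast h))
  simp only [hin]
  rw [Complex.cpow_sub _ _ haE, Complex.cpow_one, Complex.ofReal_inv]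
  field_simp
end
end

section
/- For every h ∈ H, every Φ ∈ S(F²), and every s ∈ ℂ with Re(s) > 0, one has f(s, h̄, Φ*) = f(s, h, Φ̂), where h̄ denotes the entrywise Galois conjugate of h. -/
set_option autoImplicit false

open MeasureTheory Matrix

noncomputable section

/-- The Fourier transform `Φ̂(x,y) = ∫_{F²} Φ(u,v) ψ(yu - xv) du dv`. -/
def FHat {F : Type} [Field F] [MeasurableSpace F] (μa : Measure F)
    (ψF : F → ℂ) (Φ : F × F → ℂ) : F × F → ℂ :=
  fun p => ∫ w : F × F, Φ w * ψF (p.2 * w.1 - p.1 * w.2) ∂(μa.prod μa)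

/-- The second Fourier transform `Φ*(x,y) = ∫_{F²} Φ(u,v) ψ(yu + xv) du dv`. -/
def PhiSt {F : Type} [Field F] [MeasurableSpace F] (μa : Measure F)
    (ψF : F → ℂ) (Φ : F × F → ℂ) : F × F → ℂ :=
  fun p => ∫ w : F × F, Φ w * ψF (p.2 * w.1 + p.1 * w.2) ∂(μa.prod μa)

theorem decomp_expand {F E : Type} [Field F] [Field E] [Algebra F E] (σ : E → E) (e b : E)
    (M : Matrix (Fin 2) (Fin 2) F) :
    tdiag σ b * ddiag e * M.map (algebraMap F E) * ddiag e⁻¹ =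
      !![b * e * algebraMap F E (M 0 0) * e⁻¹, b * e * algebraMap F E (M 0 1);
        (σ b)⁻¹ * algebraMap F E (M 1 0) * e⁻¹, (σ b)⁻¹ * algebraMap F E (M 1 1)] := by
  rw [Matrix.eta_fin_two (M.map (algebraMap F E))]
  simp [tdiag, ddiag, Matrix.mul_fin_two]

theorem exists_decomp_aux
    {F E : Type} [Field F] [CharZero F] [Field E] [Algebra F E] (σ : E → E)
    (hσadd : ∀ x y : E, σ (x + y) = σ x + σ y)
    (hσmul : ∀ x y : E, σ (x * y) = σ x * σ y)
    (hσinvol : ∀ x : E, σ (σ x) = x)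
    (hσfix : ∀ x : F, σ (algebraMap F E x) = algebraMap F E x)
    (sqrtε : E) (he0 : sqrtε ≠ 0) (hσsqrtε : σ sqrtε = -sqrtε)
    (hspan : ∀ x : E, ∃ a b : F, x = algebraMap F E a + algebraMap F E b * sqrtε)
    (h : Matrix (Fin 2) (Fin 2) E) (hh : h ∈ HsetM σ) :
    ∃ (b : E) (h₁ : Matrix (Fin 2) (Fin 2) F), IsDecomp σ sqrtε b h₁ h := by
  have hinj : Function.Injective (algebraMap F E) := (algebraMap F E).injective
  have h2 : (2 : E) ≠ 0 := by
    have : algebraMap F E 2 ≠ 0 := by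
      rw [Ne, map_eq_zero]; exact two_ne_zero
    rwa [map_ofNat] at this
  have s0 : σ 0 = 0 := by simpa using hσfix 0
  have s1 : σ 1 = 1 := by simpa using hσfix 1
  have sne : ∀ x, x ≠ 0 → σ x ≠ 0 := by
    intro x hx h0
    apply hx
    rw [← hσinvol x, h0, s0]
  have sinv : ∀ x, σ x⁻¹ = (σ x)⁻¹ := by
    intro x
    by_cases hx : x = 0
    · simp [hx, s0]
    · apply eq_inv_of_mul_eq_one_left
      rw [← hσmul, inv_mul_cancel₀ hx, s1]
  have hfixed : ∀ x, σ x = x → ∃ a : F, algebraMap F E a = x := by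
    intro x hx
    obtain ⟨a, b, rfl⟩ := hspan x
    rw [hσadd, hσmul, hσfix, hσfix, hσsqrtε] at hx
    have : 2 * (algebraMap F E b * sqrtε) = 0 := by linear_combination -hx
    refine ⟨a, ?_⟩
    rcases mul_eq_zero.mp this with h | h
    · exact absurd h h2
    · simp [h]
  obtain ⟨A, B, C, D, rfl⟩ : ∃ A B C D, h = !![A, B; C, D] :=
    ⟨_, _, _, _, Matrix.eta_fin_two h⟩
  have hh' : (!![A, B; C, D].map σ)ᵀ * !![(0 : E), 1; 1, 0] * !![A, B; C, D]
    = !![(0 : E), 1; 1, 0] := hh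
  have e00 := congrFun (congrFun hh' 0) 0
  have e01 := congrFun (congrFun hh' 0) 1
  have e10 := congrFun (congrFun hh' 1) 0
  have e11 := congrFun (congrFun hh' 1) 1
  simp [Matrix.mul_apply, Fin.sum_univ_two] at e00 e01 e10 e11
  by_cases hA : A = 0
  · subst hA
    simp [s0] at e00 e01 e10 e11
    have hB : B ≠ 0 := by
      rintro rfl
      simp at e01
    have hsB := sne B hB
    obtain ⟨d, hd⟩ := hfixed (-σ B * D * sqrtε⁻¹) (by
      have : σ (-σ B * D * sqrtε⁻¹) = -(B * σ D * σ (sqrtε⁻¹)) * σ (-1) * (-1) := by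
        rw [show -σ B * D * sqrtε⁻¹ = (-1) * σ B * D * sqrtε⁻¹ by ring]
        simp only [hσmul, hσinvol]
        ring
      have sm1 : σ (-1) = -1 := by simpa using hσfix (-1)
      rw [this, sinv, hσsqrtε, sm1]
      field_simp
      linear_combination e11)
    refine ⟨B * sqrtε⁻¹, !![0, 1; -1, d], mul_ne_zero hB (inv_ne_zero he0), by simp, ?_⟩
    rw [decomp_expand]
    ext i j
    fin_cases i <;> fin_cases j <;>
      simp [hd, hσmul, sinv, hσsqrtε, he0]
    · field_simp
      linear_combination e10
    · field_simp
  · have hsA := sne A hA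
    have hx : A * σ D = σ A * D := by
      linear_combination (σ A * D) * e10 - (A * σ D) * e01
        - (σ B * D) * e00 + (σ C * A) * e11
    have hBA : A * σ B = - (σ A * B) := by
      by_cases hD : D = 0
      · subst hD
        simp [s0] at e01 e10
        linear_combination (B * σ B) * e00 - (σ A * B) * e10 - (A * σ B) * e01
      · have : D * (A * σ B + σ A * B) = 0 := by
          linear_combination A * e11 - B * hx
        rcases mul_eq_zero.mp this with h | h
        · exact absurd h hD
        · linear_combination h
    obtain ⟨d, hd⟩ := hfixed (σ A * D) (by rw [hσmul, hσinvol, hx])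
    obtain ⟨c, hc⟩ := hfixed (σ A * C * sqrtε) (by
      rw [hσmul, hσmul, hσinvol, hσsqrtε]
      linear_combination (-sqrtε) * e00)
    obtain ⟨b, hb⟩ := hfixed (B * A⁻¹ * sqrtε⁻¹) (by
      rw [hσmul, hσmul, sinv, sinv, hσsqrtε]
      field_simp
      linear_combination -hBA)
    refine ⟨A, !![1, b; c, d], hA, ?_, ?_⟩
    · apply hinj
      simp only [Matrix.det_fin_two_of, map_sub, map_mul, map_one, hb, hc, hd]
      field_simp
      linear_combination A * e01 - B * e00
    · rw [decomp_expand]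
      ext i j
      fin_cases i <;> fin_cases j <;>
        simp [hb, hc, hd]
      all_goals field_simp

/-- For every `h ∈ H`, `Φ ∈ S(F²)` and `Re(s) > 0`, `f(s, h̄, Φ*) = f(s, h, Φ̂)`,
where `h̄` is the entrywise Galois conjugate of `h`. -/
theorem stmt_10
    (F : Type) [Field F] [CharZero F]
    (q : ℝ) (hq : 1 < q)
    (absF : F → ℝ)
    (habsF0 : ∀ x : F, absF x = 0 ↔ x = 0)
    (habsFmul : ∀ x y : F, absF (x * y) = absF x * absF y)
    (habsFadd : ∀ x y : F, absF (x + y) ≤ max (absF x) (absF y))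
    (ϖ : F) (hϖ : absF ϖ = q⁻¹)
    (hvalF : ∀ x : F, x ≠ 0 → ∃ m : ℤ, absF x = q ^ m)
    (habsF2 : absF 2 = 1)
    [MeasurableSpace F]
    (habsFmeas : Measurable absF)
    (hFmulmeas : Measurable fun p : F × F => p.1 * p.2)
    (hFaddmeas : Measurable fun p : F × F => p.1 + p.2)
    (μ : Measure F) [SigmaFinite μ]
    (hμ0 : μ {0} = 0)
    (hμinv : ∀ a : F, a ≠ 0 → Measure.map (fun x => a * x) μ = μ)
    (hμ1 : μ {x : F | absF x = 1} = 1)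
    (μa : Measure F) [SigmaFinite μa]
    (hμaadd : ∀ v : F, Measure.map (fun x => x + v) μa = μa)
    (hμasc : ∀ a : F, a ≠ 0 →
      Measure.map (fun x => a * x) μa = ENNReal.ofReal ((absF a)⁻¹) • μa)
    (hμa1 : μa {x : F | absF x ≤ 1} = 1)
    (ψF : F → ℂ) (hψmeas : Measurable ψF)
    (hψadd : ∀ x y : F, ψF (x + y) = ψF x * ψF y)
    (hψtriv : ∀ x : F, absF x ≤ 1 → ψF x = 1)
    (hψnontriv : ∃ x : F, absF x ≤ q ∧ ψF x ≠ 1)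
    (E : Type) [Field E] [Algebra F E]
    (σ : E → E)
    (hσadd : ∀ x y : E, σ (x + y) = σ x + σ y)
    (hσmul : ∀ x y : E, σ (x * y) = σ x * σ y)
    (hσinvol : ∀ x : E, σ (σ x) = x)
    (hσfix : ∀ x : F, σ (algebraMap F E x) = algebraMap F E x)
    (ε : F) (sqrtε : E)
    (hεabs : absF ε = 1)
    (hεnonsq : ∀ a : F, a * a ≠ ε)
    (hsqrtε : sqrtε * sqrtε = algebraMap F E ε)
    (hσsqrtε : σ sqrtε = -sqrtε)
    (hspan : ∀ x : E, ∃ a b : F, x = algebraMap F E a + algebraMap F E b * sqrtε)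
    (absE : E → ℝ)
    (habsE0 : ∀ x : E, absE x = 0 ↔ x = 0)
    (habsEmul : ∀ x y : E, absE (x * y) = absE x * absE y)
    (habsEadd : ∀ x y : E, absE (x + y) ≤ max (absE x) (absE y))
    (habsEF : ∀ x : F, absE (algebraMap F E x) = absF x ^ 2)
    (habsEconj : ∀ x : E, absE (σ x) = absE x)
    (habsEspan : ∀ a b : F,
      absE (algebraMap F E a + algebraMap F E b * sqrtε) = max (absF a ^ 2) (absF b ^ 2))
    (hvalE : ∀ x : E, x ≠ 0 → ∃ m : ℤ, absE x = (q ^ 2) ^ m)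
    (fE : ℂ → Matrix (Fin 2) (Fin 2) E → (F × F → ℂ) → ℂ)
    (hfE : ∀ (s : ℂ) (h : Matrix (Fin 2) (Fin 2) E) (Φ : F × F → ℂ)
      (b : E) (h₁ : Matrix (Fin 2) (Fin 2) F), IsDecomp σ sqrtε b h₁ h →
      fE s h Φ = Complex.ofReal (absE b) ^ s * zInt μ absF s h₁ Φ)
    [TopologicalSpace F]
    (Φ : F × F → ℂ) (hΦmeas : Measurable Φ)
    (hΦlc : IsLocallyConstant Φ) (hΦcs : HasCompactSupport Φ)
    (h : Matrix (Fin 2) (Fin 2) E) (hh : h ∈ HsetM σ)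
    (s : ℂ) (hs : 0 < s.re) :
    fE s (h.map σ) (PhiSt μa ψF Φ) = fE s h (FHat μa ψF Φ) := by
  have he0 : sqrtε ≠ 0 := by
    rintro rfl
    have h0 : ε = 0 := by
      have : algebraMap F E ε = 0 := by rw [← hsqrtε, mul_zero]
      simpa using this
    rw [h0, (habsF0 0).mpr rfl] at hεabs
    exact zero_ne_one hεabs
  obtain ⟨b, h₁, hd⟩ := exists_decomp_aux σ hσadd hσmul hσinvol hσfix sqrtε he0 hσsqrtε
    hspan h hh
  have s0 : σ 0 = 0 := by simpa using hσfix 0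
  have s1 : σ 1 = 1 := by simpa using hσfix 1
  have sinv : ∀ x, σ x⁻¹ = (σ x)⁻¹ := by
    intro x
    by_cases hx : x = 0
    · simp [hx, s0]
    · apply eq_inv_of_mul_eq_one_left
      rw [← hσmul, inv_mul_cancel₀ hx, s1]
  have hd' : IsDecomp σ sqrtε (σ b) !![h₁ 0 0, -h₁ 0 1; -h₁ 1 0, h₁ 1 1] (h.map σ) := by
    obtain ⟨hb, hdet, rfl⟩ := hd
    refine ⟨?_, ?_, ?_⟩
    · intro h0
      apply hb
      rw [← hσinvol b, h0, s0]
    · rw [Matrix.det_fin_two] at hdet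
      simp [Matrix.det_fin_two_of, hdet]
    · rw [decomp_expand, decomp_expand]
      ext i j
      fin_cases i <;> fin_cases j <;>
        simp [hσmul, sinv, hσfix, hσsqrtε,
          hσinvol, s0]
  rw [hfE s _ _ _ _ hd', hfE s _ _ _ _ hd, habsEconj]
  congr 1
  unfold zInt
  congr 1
  funext r
  congr 1
  unfold PhiSt FHat
  simp [sub_eq_add_neg]
end
end

section
/- Let W: H → ℂ be left-invariant under U_H, let Φ ∈ S(F²), and let s ∈ ℂ with Re(s) > 0 be such that the integrals below converge absolutely. Define W̄(h) = W(h̄), where h̄ is the entrywise Galois conjugate of h. Then Z(s, W, Φ̂) = Z(s, W̄, Φ*), where for a left U_H-invariant function V and Ψ ∈ S(F²), Z(s, V, Ψ) = ∫_{E^×} ∫_{K_{0,H}} V(t(a)k)·f(s, t(a)k, Ψ)·|a|_E^{-1} d^×a dk. -/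
set_option autoImplicit false

open MeasureTheory Matrix

noncomputable section

section helpers

variable {F E : Type} [Field F] [Field E] [Algebra F E]

lemma aux_fixed [CharZero F] (τ : E →+* E) (hσfix : ∀ x : F, τ (algebraMap F E x) = algebraMap F E x)
    (sqrtε : E) (h0 : sqrtε ≠ 0) (hσsqrtε : τ sqrtε = -sqrtε)
    (hspan : ∀ x : E, ∃ a b : F, x = algebraMap F E a + algebraMap F E b * sqrtε)
    (x : E) (hx : τ x = x) : ∃ a : F, algebraMap F E a = x := by
  obtain ⟨a, b, rfl⟩ := hspan x
  simp only [map_add, map_mul, hσfix, hσsqrtε] at hx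
  have : algebraMap F E (2 * b) * sqrtε = 0 := by
    rw [map_mul, map_ofNat]; linear_combination -hx
  have h2 : algebraMap F E (2 * b) = 0 := by simpa [h0] using this
  have h3 : b = 0 := by
    have := (map_eq_zero _).1 h2
    simpa using this
  exact ⟨a, by simp [h3]⟩

lemma aux_rel (τ : E →+* E) {a b c d : E} (h : !![a, b; c, d] ∈ HsetM τ) :
    τ c * a + τ a * c = 0 ∧ τ c * b + τ a * d = 1 ∧ τ d * a + τ b * c = 1 ∧
    τ d * b + τ b * d = 0 ∧ c * τ d + d * τ c = 0 ∧ a * τ d + b * τ c = 1 := by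
  have h1 : (!![a, b; c, d].map τ)ᵀ * !![(0 : E), 1; 1, 0] * !![a, b; c, d]
    = !![(0 : E), 1; 1, 0] := h
  have e : (!![a, b; c, d].map τ)ᵀ = !![τ a, τ c; τ b, τ d] := by
    ext i j; fin_cases i <;> fin_cases j <;> rfl
  rw [e] at h1
  have h2 : (!![τ d, τ b; τ c, τ a] : Matrix (Fin 2) (Fin 2) E) * !![a, b; c, d] = 1 := by
    have h00 := congrFun (congrFun h1 0) 0
    have h01 := congrFun (congrFun h1 0) 1
    have h10 := congrFun (congrFun h1 1) 0
    have h11 := congrFun (congrFun h1 1) 1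
    simp [Matrix.mul_apply, Fin.sum_univ_two] at h00 h01 h10 h11
    ext i j; fin_cases i <;> fin_cases j <;> simp [Matrix.mul_apply, Fin.sum_univ_two, *]
  have h3 := mul_eq_one_comm.1 h2
  have g00 := congrFun (congrFun h2 0) 0
  have g01 := congrFun (congrFun h2 0) 1
  have g10 := congrFun (congrFun h2 1) 0
  have g11 := congrFun (congrFun h2 1) 1
  have k00 := congrFun (congrFun h3 0) 0
  have k10 := congrFun (congrFun h3 1) 0
  simp [Matrix.mul_apply, Fin.sum_univ_two] at g00 g01 g10 g11 k00 k10
  exact ⟨g10, g11, g00, g01, k10, k00⟩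

lemma aux_prod (τ : E →+* E) (b e : E) (h : Matrix (Fin 2) (Fin 2) F) :
    tdiag τ b * ddiag e * h.map (algebraMap F E) * ddiag e⁻¹ =
      !![b * e * algebraMap F E (h 0 0) * e⁻¹, b * e * algebraMap F E (h 0 1);
        (τ b)⁻¹ * algebraMap F E (h 1 0) * e⁻¹, (τ b)⁻¹ * algebraMap F E (h 1 1)] := by
  rw [Matrix.eta_fin_two (h.map (algebraMap F E))]
  simp [tdiag, ddiag, Matrix.mul_fin_two]

lemma aux_decomp_s11 [CharZero F] (τ : E →+* E) (hinv : ∀ x, τ (τ x) = x)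
    (hσfix : ∀ x : F, τ (algebraMap F E x) = algebraMap F E x)
    (sqrtε : E) (h0 : sqrtε ≠ 0) (hσsqrtε : τ sqrtε = -sqrtε)
    (hspan : ∀ x : E, ∃ a b : F, x = algebraMap F E a + algebraMap F E b * sqrtε)
    (h : Matrix (Fin 2) (Fin 2) E) (hh : h ∈ HsetM τ) :
    ∃ b h₁, IsDecomp (F := F) τ sqrtε b h₁ h := by
  obtain ⟨a, b, c, d, rfl⟩ : ∃ a b c d, h = !![a, b; c, d] :=
    ⟨_, _, _, _, Matrix.eta_fin_two h⟩
  obtain ⟨r1, r2, r3, r4, r5, r6⟩ := aux_rel τ hh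
  have fx := aux_fixed τ hσfix sqrtε h0 hσsqrtε hspan
  by_cases hd : d = 0
  · subst hd
    simp only [map_zero, mul_zero, zero_mul, zero_add, add_zero] at *
    have hc : c ≠ 0 := by rintro rfl; simp at r6
    have hc' : τ c ≠ 0 := by simpa using hc
    obtain ⟨x, hx⟩ := fx (-a * τ c * sqrtε) (by
      simp only [map_mul, map_neg, hinv, hσsqrtε]
      linear_combination sqrtε * r1)
    refine ⟨(-(τ c * sqrtε))⁻¹, !![x, -1; 1, 0], by simp [hc, h0], by simp [Matrix.det_fin_two], ?_⟩
    rw [aux_prod]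
    ext i j
    fin_cases i <;> fin_cases j <;>
      simp [hx, hinv, hσsqrtε]
    · field_simp
    · field_simp
      linear_combination r6
    · field_simp
  · have hd' : τ d ≠ 0 := by simpa using hd
    obtain ⟨x, hx⟩ := fx (a * τ d) (by
      simp only [map_mul, hinv]
      linear_combination r2 - r6)
    obtain ⟨y, hy⟩ := fx (b * τ d / sqrtε) (by
      simp only [map_mul, map_div₀, hinv, hσsqrtε]
      field_simp
      linear_combination -r4)
    obtain ⟨z, hz⟩ := fx (sqrtε * c / d) (by
      simp only [map_mul, map_div₀, hinv, hσsqrtε]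
      field_simp
      linear_combination -r5)
    refine ⟨(τ d)⁻¹, !![x, y; z, 1], by simp [hd], ?_, ?_⟩
    · apply (algebraMap F E).injective
      simp only [Matrix.det_fin_two_of, map_sub, map_mul, hx, hy, hz, map_one]
      field_simp
      linear_combination d * r6 - b * r5
    rw [aux_prod]
    ext i j
    fin_cases i <;> fin_cases j <;>
      simp [hx, hy, hz, hinv] <;>
      field_simp

lemma aux_decomp_conj (τ : E →+* E) 
    (hσfix : ∀ x : F, τ (algebraMap F E x) = algebraMap F E x)
    (sqrtε : E) (hσsqrtε : τ sqrtε = -sqrtε)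
    (h : Matrix (Fin 2) (Fin 2) E) (b : E) (h₁ : Matrix (Fin 2) (Fin 2) F)
    (H : IsDecomp τ sqrtε b h₁ h) :
    IsDecomp τ sqrtε (τ b) !![h₁ 0 0, -h₁ 0 1; -h₁ 1 0, h₁ 1 1] (h.map τ) := by
  obtain ⟨h1, h2, rfl⟩ := H
  refine ⟨by simpa using h1, ?_, ?_⟩
  · rw [← h2]; simp [Matrix.det_fin_two]
  · rw [aux_prod, aux_prod]
    ext i j
    fin_cases i <;> fin_cases j <;>
      simp [hσfix, hσsqrtε]

lemma aux_map_mul (τ : E →+* E) (a : E) (k : Matrix (Fin 2) (Fin 2) E) :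
    (tdiag τ a * k).map τ = tdiag τ (τ a) * k.map τ := by
  rw [Matrix.map_mul]
  congr 1
  ext i j
  fin_cases i <;> fin_cases j <;> simp [tdiag]

lemma aux_mem (τ : E →+* E) (hinv : ∀ x, τ (τ x) = x) (a : E) (ha : a ≠ 0)
    (k : Matrix (Fin 2) (Fin 2) E)
    (hk : k ∈ HsetM τ) : tdiag τ a * k ∈ HsetM τ := by
  have ha' : τ a ≠ 0 := by simpa using ha
  have h1 : ((tdiag τ a).map τ)ᵀ * !![(0 : E), 1; 1, 0] * tdiag τ a = !![(0 : E), 1; 1, 0] := by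
    ext i j
    fin_cases i <;> fin_cases j <;>
      simp [tdiag, Matrix.mul_apply, Fin.sum_univ_two, ha, ha', hinv]
  have h2 : (k.map τ)ᵀ * !![(0 : E), 1; 1, 0] * k = !![(0 : E), 1; 1, 0] := hk
  show ((tdiag τ a * k).map τ)ᵀ * !![(0 : E), 1; 1, 0] * (tdiag τ a * k) = !![(0 : E), 1; 1, 0]
  rw [Matrix.map_mul, Matrix.transpose_mul]
  calc _ = (k.map τ)ᵀ * (((tdiag τ a).map τ)ᵀ * !![(0 : E), 1; 1, 0] * tdiag τ a) * k := by
        simp only [Matrix.mul_assoc]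
    _ = _ := by rw [h1, h2]

lemma aux_z [MeasurableSpace F] (μ μa : Measure F) (absF : F → ℝ) (s : ℂ) (ψF : F → ℂ)
    (Φ : F × F → ℂ) (g : Matrix (Fin 2) (Fin 2) F) :
    zInt μ absF s !![g 0 0, -g 0 1; -g 1 0, g 1 1] (FHat μa ψF Φ) =
      zInt μ absF s g (PhiSt μa ψF Φ) := by
  simp [zInt, FHat, PhiSt]

end helpers

/-- For `W` left `U_H`-invariant and `Φ ∈ S(F²)`, with absolutely convergent integrals,
`Z(s, W, Φ̂) = Z(s, W̄, Φ*)`, where `W̄(h) = W(h̄)`. -/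
theorem stmt_11
    (F : Type) [Field F] [CharZero F]
    (q : ℝ) (hq : 1 < q)
    (absF : F → ℝ)
    (habsF0 : ∀ x : F, absF x = 0 ↔ x = 0)
    (habsFmul : ∀ x y : F, absF (x * y) = absF x * absF y)
    (habsFadd : ∀ x y : F, absF (x + y) ≤ max (absF x) (absF y))
    (ϖ : F) (hϖ : absF ϖ = q⁻¹)
    (hvalF : ∀ x : F, x ≠ 0 → ∃ m : ℤ, absF x = q ^ m)
    (habsF2 : absF 2 = 1)
    [MeasurableSpace F]
    (habsFmeas : Measurable absF)
    (hFmulmeas : Measurable fun p : F × F => p.1 * p.2)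
    (hFaddmeas : Measurable fun p : F × F => p.1 + p.2)
    (μ : Measure F) [SigmaFinite μ]
    (hμ0 : μ {0} = 0)
    (hμinv : ∀ a : F, a ≠ 0 → Measure.map (fun x => a * x) μ = μ)
    (hμ1 : μ {x : F | absF x = 1} = 1)
    (μa : Measure F) [SigmaFinite μa]
    (hμaadd : ∀ v : F, Measure.map (fun x => x + v) μa = μa)
    (hμasc : ∀ a : F, a ≠ 0 →
      Measure.map (fun x => a * x) μa = ENNReal.ofReal ((absF a)⁻¹) • μa)
    (hμa1 : μa {x : F | absF x ≤ 1} = 1)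
    (ψF : F → ℂ) (hψmeas : Measurable ψF)
    (hψadd : ∀ x y : F, ψF (x + y) = ψF x * ψF y)
    (hψtriv : ∀ x : F, absF x ≤ 1 → ψF x = 1)
    (hψnontriv : ∃ x : F, absF x ≤ q ∧ ψF x ≠ 1)
    (E : Type) [Field E] [Algebra F E]
    (σ : E → E)
    (hσadd : ∀ x y : E, σ (x + y) = σ x + σ y)
    (hσmul : ∀ x y : E, σ (x * y) = σ x * σ y)
    (hσinvol : ∀ x : E, σ (σ x) = x)
    (hσfix : ∀ x : F, σ (algebraMap F E x) = algebraMap F E x)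
    (ε : F) (sqrtε : E)
    (hεabs : absF ε = 1)
    (hεnonsq : ∀ a : F, a * a ≠ ε)
    (hsqrtε : sqrtε * sqrtε = algebraMap F E ε)
    (hσsqrtε : σ sqrtε = -sqrtε)
    (hspan : ∀ x : E, ∃ a b : F, x = algebraMap F E a + algebraMap F E b * sqrtε)
    (absE : E → ℝ)
    (habsE0 : ∀ x : E, absE x = 0 ↔ x = 0)
    (habsEmul : ∀ x y : E, absE (x * y) = absE x * absE y)
    (habsEadd : ∀ x y : E, absE (x + y) ≤ max (absE x) (absE y))
    (habsEF : ∀ x : F, absE (algebraMap F E x) = absF x ^ 2)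
    (habsEconj : ∀ x : E, absE (σ x) = absE x)
    (habsEspan : ∀ a b : F,
      absE (algebraMap F E a + algebraMap F E b * sqrtε) = max (absF a ^ 2) (absF b ^ 2))
    (hvalE : ∀ x : E, x ≠ 0 → ∃ m : ℤ, absE x = (q ^ 2) ^ m)
    [MeasurableSpace E]
    (habsEmeas : Measurable absE) (hσmeas : Measurable σ)
    (hEmulmeas : Measurable fun p : E × E => p.1 * p.2)
    (μE : Measure E) [SigmaFinite μE]
    (hμE0 : μE {0} = 0)
    (hμEinv : ∀ a : E, a ≠ 0 → Measure.map (fun x => a * x) μE = μE)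
    (hμE1 : μE {x : E | absE x = 1} = 1)
    [MeasurableSpace (Matrix (Fin 2) (Fin 2) E)]
    (κ : Measure (Matrix (Fin 2) (Fin 2) E)) [SigmaFinite κ]
    (hκmeas : MeasurableSet (KHset q σ absE (0 : ℤ)))
    (hκ1 : κ (KHset q σ absE (0 : ℤ)) = 1)
    (hκcompl : κ ((KHset q σ absE (0 : ℤ))ᶜ) = 0)
    (fE : ℂ → Matrix (Fin 2) (Fin 2) E → (F × F → ℂ) → ℂ)
    (hfE : ∀ (s : ℂ) (h : Matrix (Fin 2) (Fin 2) E) (Φ : F × F → ℂ)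
      (b : E) (h₁ : Matrix (Fin 2) (Fin 2) F), IsDecomp σ sqrtε b h₁ h →
      fE s h Φ = Complex.ofReal (absE b) ^ s * zInt μ absF s h₁ Φ)
    (hμEconj : Measure.map σ μE = μE)
    (hκconj : Measure.map (fun m : Matrix (Fin 2) (Fin 2) E => m.map σ) κ = κ)
    [TopologicalSpace F]
    (Φ : F × F → ℂ) (hΦmeas : Measurable Φ)
    (hΦlc : IsLocallyConstant Φ) (hΦcs : HasCompactSupport Φ)
    (W : Matrix (Fin 2) (Fin 2) E → ℂ)
    (hWU : ∀ u ∈ UHsetM σ, ∀ h ∈ HsetM σ, W (u * h) = W h)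
    (s : ℂ) (hs : 0 < s.re)
    (hint1 : Integrable (fun p : E × Matrix (Fin 2) (Fin 2) E =>
      W (tdiag σ p.1 * p.2) * fE s (tdiag σ p.1 * p.2) (FHat μa ψF Φ) *
        Complex.ofReal ((absE p.1)⁻¹)) (μE.prod κ))
    (hint2 : Integrable (fun p : E × Matrix (Fin 2) (Fin 2) E =>
      W ((tdiag σ p.1 * p.2).map σ) * fE s (tdiag σ p.1 * p.2) (PhiSt μa ψF Φ) *
        Complex.ofReal ((absE p.1)⁻¹)) (μE.prod κ)) :
    (∫ a : E, (∫ k, W (tdiag σ a * k) * fE s (tdiag σ a * k) (FHat μa ψF Φ) ∂κ) *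
        Complex.ofReal ((absE a)⁻¹) ∂μE)
      = (∫ a : E, (∫ k, W ((tdiag σ a * k).map σ) *
          fE s (tdiag σ a * k) (PhiSt μa ψF Φ) ∂κ) *
          Complex.ofReal ((absE a)⁻¹) ∂μE) := by
  obtain ⟨τ, rfl⟩ : ∃ τ : E →+* E, ⇑τ = σ := by
    refine ⟨⟨⟨⟨σ, ?_⟩, hσmul⟩, ?_, hσadd⟩, rfl⟩
    · simpa using hσfix 1
    · simpa using hσfix 0
  have hε0 : ε ≠ 0 := by
    rintro rfl
    exact hεnonsq 0 (by simp)
  have h0 : sqrtε ≠ 0 := by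
    rintro rfl
    apply hε0
    simpa using hsqrtε.symm
  -- the key pointwise identity
  have key : ∀ h ∈ HsetM τ, fE s (h.map τ) (FHat μa ψF Φ) = fE s h (PhiSt μa ψF Φ) := by
    intro h hh
    obtain ⟨b, h₁, hd⟩ := aux_decomp_s11 (F := F) τ hσinvol hσfix sqrtε h0 hσsqrtε hspan h hh
    rw [hfE s h _ b h₁ hd, hfE s _ _ _ _ (aux_decomp_conj τ hσfix sqrtε hσsqrtε h b h₁ hd),
      habsEconj, aux_z]
  let e : E ≃ᵐ E := ⟨⟨τ, τ, hσinvol, hσinvol⟩, hσmeas, hσmeas⟩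
  have he : MeasurePreserving e μE μE := ⟨hσmeas, hμEconj⟩
  have hcm : AEMeasurable (fun m : Matrix (Fin 2) (Fin 2) E => m.map τ) κ := by
    by_contra hcon
    rw [Measure.map_of_not_aemeasurable hcon] at hκconj
    rw [← hκconj] at hκ1
    simp at hκ1
  have hae0 : ∀ᵐ a ∂μE, a ≠ 0 := by
    rw [ae_iff]; simpa using hμE0
  have haeK : ∀ᵐ k ∂κ, k ∈ HsetM τ := by
    have : ∀ᵐ k ∂κ, k ∈ KHset q τ absE (0 : ℤ) := by
      rw [ae_iff]; exact hκcompl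
    filter_upwards [this] with k hk using hk.1
  have hsm := he.quasiMeasurePreserving.ae hint1.prod_right_ae
  rw [← he.integral_comp' (g := fun a : E => (∫ k, W (tdiag τ a * k) *
    fE s (tdiag τ a * k) (FHat μa ψF Φ) ∂κ) * Complex.ofReal ((absE a)⁻¹))]
  apply integral_congr_ae
  filter_upwards [hsm, hae0] with a ha ha0
  change Integrable (fun k => W (tdiag τ (τ a) * k) * fE s (tdiag τ (τ a) * k) (FHat μa ψF Φ) *
        Complex.ofReal ((absE (τ a))⁻¹)) κ at ha
  change (∫ k, W (tdiag τ (τ a) * k) *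
    fE s (tdiag τ (τ a) * k) (FHat μa ψF Φ) ∂κ) * Complex.ofReal ((absE (τ a))⁻¹) = _
  rw [habsEconj] at ha ⊢
  have hne : Complex.ofReal ((absE a)⁻¹) ≠ 0 := by
    simpa [habsE0] using ha0
  have ha2 : Integrable (fun k => W (tdiag τ (τ a) * k) *
      fE s (tdiag τ (τ a) * k) (FHat μa ψF Φ)) κ := by
    have := ha.mul_const (Complex.ofReal ((absE a)⁻¹))⁻¹
    simpa only [mul_assoc, mul_inv_cancel₀ hne, mul_one] using this
  congr 1
  have hch := integral_map hcm (f := fun k => W (tdiag τ (τ a) * k) *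
      fE s (tdiag τ (τ a) * k) (FHat μa ψF Φ)) (by rw [hκconj]; exact ha2.1)
  rw [hκconj] at hch
  rw [hch]
  apply integral_congr_ae
  filter_upwards [haeK] with k hk
  rw [← aux_map_mul, key _ (aux_mem τ hσinvol a ha0 k hk)]
end
end
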